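/- arXiv:1902.01744 — 2 statements merged into one kernel-verified Lean document; each statement's English description precedes it below -/
import Mathlib

section
/- Let u be real analytic on an open neighborhood of the origin in ℝ² with J[Δu, det D²u] ≡ 0, D²u(0,0) = λ·Id for some λ ∈ ℝ, and u not a polynomial of degree at most two. Let w be the lowest-degree non-zero homogeneous polynomial, of degree n+2 ≥ 3, in the Taylor expansion at the origin of u minus its second-order Taylor polynomial, and assume w(x,y) = a·ℓ(x,y)^{n+2} for some a ≠ 0 and some non-zero linear form ℓ. Then there exist ε > 0, a real analytic function s on the disk D(ε) of radius ε about the origin with s(0,0) = 0 and ∇s(0,0) ≠ (0,0), and a real analytic map B from D(ε) to traceless symmetric 2×2 matrices with B(0,0) ≠ 0, such that D²u(p) − (Δu(p)/2)·Id = s(p)ⁿ B(p) for all p ∈ D(ε). In particular, the set of p ∈ D(ε) at which D²u(p) is a scalar multiple of the identity equals the regular real analytic curve {s = 0} through the origin, and the eigendirection fields of D²u extend real analytically across this curve. -/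
open Set Metric Topology Asymptotics MvPolynomial Matrix

/-- Partial derivative with respect to the first variable. -/
noncomputable def pdx (f : ℝ × ℝ → ℝ) (p : ℝ × ℝ) : ℝ :=
  deriv (fun x => f (x, p.2)) p.1

/-- Partial derivative with respect to the second variable. -/
noncomputable def pdy (f : ℝ × ℝ → ℝ) (p : ℝ × ℝ) : ℝ :=
  deriv (fun y => f (p.1, y)) p.2

/-- The Laplacian `Δu = u_xx + u_yy`. -/
noncomputable def lap (f : ℝ × ℝ → ℝ) (p : ℝ × ℝ) : ℝ :=
  pdx (pdx f) p + pdy (pdy f) p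

/-- The Hessian determinant `det D²u = u_xx u_yy - u_xy²`. -/
noncomputable def hessDet (f : ℝ × ℝ → ℝ) (p : ℝ × ℝ) : ℝ :=
  pdx (pdx f) p * pdy (pdy f) p - (pdx (pdy f) p) ^ 2

/-- The Jacobian `J[f,g] = f_x g_y - f_y g_x`. -/
noncomputable def jacDet (f g : ℝ × ℝ → ℝ) (p : ℝ × ℝ) : ℝ :=
  pdx f p * pdy g p - pdy f p * pdx g p


/-! ### Derivations and prime divisors -/

section Derivation

variable {R : Type*} [CommRing R] [Algebra ℂ R]

/-- A derivation which does not preserve the ideal of a prime lowers multiplicities by one. -/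
theorem emultiplicity_derivation_add_one [IsDomain R] [WfDvdMonoid R] (D : Derivation ℂ R R)
    {p f : R} (hp : Prime p) (hD : ¬p ∣ D p) (hf : p ∣ f) (hf0 : f ≠ 0) :
    emultiplicity p (D f) + 1 = emultiplicity p f := by
  have hfin : FiniteMultiplicity p f := FiniteMultiplicity.of_prime_left hp hf0
  obtain ⟨g, hfg, hg⟩ := hfin.exists_eq_pow_mul_and_not_dvd
  obtain ⟨j, hj⟩ : ∃ j, multiplicity p f = j + 1 :=
    Nat.exists_eq_succ_of_ne_zero (multiplicity_pos_of_dvd hf).ne'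
  rw [hj] at hfg
  have hDf : D f = p ^ j * (((j + 1 : ℕ) : R) * D p * g + p * D g) := by
    rw [hfg, D.leibniz, D.leibniz_pow]
    simp only [smul_eq_mul, nsmul_eq_mul, Nat.add_sub_cancel]
    ring
  have hnd : ¬p ∣ ((j + 1 : ℕ) : R) * D p * g + p * D g := by
    rw [dvd_add_left (dvd_mul_right _ _), hp.dvd_mul, hp.dvd_mul]
    rintro ((h | h) | h)
    · have hu : IsUnit (((j + 1 : ℕ) : R)) := by
        have : IsUnit (((j + 1 : ℕ) : ℂ)) := isUnit_iff_ne_zero.2 (by exact_mod_cast j.succ_ne_zero)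
        simpa using this.map (algebraMap ℂ R)
      exact hp.not_isUnit (isUnit_of_dvd_unit h hu)
    · exact hD h
    · exact hg h
  rw [hDf, emultiplicity_mul hp, emultiplicity_eq_zero.2 hnd, hfin.emultiplicity_eq_multiplicity,
    hj, emultiplicity_pow_self_of_prime hp]
  simp

/-- If a derivation preserves the ideal generated by `p`, so do its iterates. -/
theorem dvd_iterate_derivation (D : Derivation ℂ R R) {p f : R} (hp : p ∣ D p) (hf : p ∣ f)
    (k : ℕ) : p ∣ D^[k] f := by
  induction k generalizing f with
  | zero => simpa
  | succ k ih =>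
    rw [Function.iterate_succ_apply]
    apply ih
    obtain ⟨g, rfl⟩ := hf
    rw [D.leibniz, smul_eq_mul, smul_eq_mul]
    exact dvd_add (dvd_mul_right _ _) (hp.mul_left _)

theorem derivation_mem_pow (D : Derivation ℂ R R) {I : Ideal R} {k : ℕ} {f : R}
    (hf : f ∈ I ^ (k + 1)) : D f ∈ I ^ k := by
  induction k generalizing f with
  | zero => simp
  | succ k ih =>
    rw [pow_succ] at hf
    induction hf using Submodule.mul_induction_on' with
    | mem_mul_mem a ha b hb =>
      rw [D.leibniz, smul_eq_mul, smul_eq_mul]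
      refine add_mem (Ideal.mul_mem_right _ _ ha) ?_
      rw [pow_succ']
      exact Ideal.mul_mem_mul hb (ih ha)
    | add a _ b _ ha hb =>
      rw [map_add]
      exact add_mem ha hb

/-- If `f` has leading part `c a ^ n` and `D a` is a unit, then `D ^ n f` is a unit. -/
theorem isUnit_iterate_derivation [IsLocalRing R] (D : Derivation ℂ R R) {a : R}
    (ha : a ∈ IsLocalRing.maximalIdeal R) (hDa : IsUnit (D a)) {n : ℕ} {c f : R} (hc : IsUnit c)
    (hf : f - c * a ^ n ∈ IsLocalRing.maximalIdeal R ^ (n + 1)) : IsUnit (D^[n] f) := by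
  induction n generalizing c f with
  | zero =>
    by_contra h
    have h1 : f ∈ IsLocalRing.maximalIdeal R := h
    have h2 : c ∈ IsLocalRing.maximalIdeal R := by
      have := sub_mem h1 (by simpa using hf)
      simpa using this
    exact h2 hc
  | succ n ih =>
    rw [Function.iterate_succ_apply]
    have hu : IsUnit (((n + 1 : ℕ) : R)) := by
      have : IsUnit (((n + 1 : ℕ) : ℂ)) := isUnit_iff_ne_zero.2 (by exact_mod_cast n.succ_ne_zero)
      simpa using this.map (algebraMap ℂ R)
    refine ih (c := c * ((n + 1 : ℕ) : R) * D a) ((hc.mul hu).mul hDa) ?_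
    have h1 := derivation_mem_pow D hf
    have h2 : D c * a ^ (n + 1) ∈ IsLocalRing.maximalIdeal R ^ (n + 1) :=
      Ideal.mul_mem_left _ _ (Ideal.pow_mem_pow ha _)
    convert add_mem h1 h2 using 1
    rw [map_sub, D.leibniz, D.leibniz_pow]
    simp only [smul_eq_mul, nsmul_eq_mul, Nat.add_sub_cancel]
    ring

end Derivation

/-! ### Power series over a differential ring -/

namespace PowerSeries

section DifferentialCoefficients

variable {A : Type*} [CommRing A] [Algebra ℂ A]

variable (A) in
/-- The derivative in the variable `X`, as a derivation over `ℂ`. -/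
noncomputable def dX : Derivation ℂ (PowerSeries A) (PowerSeries A) :=
  (derivative A).restrictScalars ℂ

/-- The derivation obtained by applying a derivation to all coefficients. -/
noncomputable def dCoeff (d : Derivation ℂ A A) : Derivation ℂ (PowerSeries A) (PowerSeries A) :=
  Derivation.mk'
    { toFun := fun f => mk fun i => d (coeff i f)
      map_add' := fun f g => by ext1 i; simp
      map_smul' := fun r f => by ext1 i; simp }
    fun f g => by
      ext1 i
      simp only [LinearMap.coe_mk, AddHom.coe_mk, smul_eq_mul, map_add, coeff_mk,
        coeff_mul, map_sum, Derivation.leibniz]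
      rw [Finset.sum_add_distrib]
      congr 1
      rw [← Finset.Nat.sum_antidiagonal_swap]
      simp

theorem coeff_dX (f : PowerSeries A) (i : ℕ) :
    coeff i (dX A f) = coeff (i + 1) f * (i + 1) :=
  coeff_derivative f i

theorem coeff_dCoeff (d : Derivation ℂ A A) (f : PowerSeries A) (i : ℕ) :
    coeff i (dCoeff d f) = d (coeff i f) := by
  simp [dCoeff]

theorem dX_C (a : A) : dX A (C a) = 0 := derivative_C

theorem dCoeff_C (d : Derivation ℂ A A) (a : A) : dCoeff d (C a) = C (d a) := by
  ext1 i
  rw [coeff_dCoeff, coeff_C, coeff_C]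
  split_ifs <;> simp

theorem dX_X : dX A X = 1 := by
  ext1 i; rw [coeff_dX]; rcases i with _ | i <;> simp [coeff_X, coeff_one]

theorem dCoeff_X (d : Derivation ℂ A A) : dCoeff d X = 0 := by
  ext1 i
  rw [coeff_dCoeff, coeff_X]
  split_ifs <;> simp

variable [IsDomain A] [IsLocalRing A] [IsAdicComplete (IsLocalRing.maximalIdeal A) A]

/-- An irreducible power series which is regular in `X` and divides the Jacobian of itself with `H`
divides `H` up to an additive constant. -/
theorem dvd_of_dvd_jacobian [IsIntegrallyClosed A] (d : Derivation ℂ A A)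
    (hd : ∀ a, d a = 0 → ∃ z : ℂ, a = algebraMap ℂ A z) {p H : PowerSeries A}
    (hp : Prime p) (hreg : p.map (IsLocalRing.residue A) ≠ 0) (hpX : ¬p ∣ dX A p)
    (hinj : ∀ a : A, p ∣ C a → a = 0)
    (hJ : p ∣ dX A p * dCoeff d H - dCoeff d p * dX A H) (hH : ¬IsUnit H) : p ∣ H := by
  have hprime : (Ideal.span {p}).IsPrime := (Ideal.span_singleton_prime hp.ne_zero).2 hp
  let S := PowerSeries A ⧸ Ideal.span {p}
  let π : PowerSeries A →ₐ[A] S := Ideal.Quotient.mkₐ A _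
  have hπ : ∀ g, π g = 0 ↔ p ∣ g := fun g =>
    Ideal.Quotient.eq_zero_iff_mem.trans Ideal.mem_span_singleton
  have hfaith : Module.IsTorsionFree A S := by
    have : FaithfulSMul A S := by
      refine (faithfulSMul_iff_algebraMap_injective A S).2
        ((injective_iff_map_eq_zero _).2 fun a ha => ?_)
      exact hinj a ((hπ (C a)).1 ha)
    infer_instance
  have hint : IsIntegral A (π H) := by
    have hmon := (p.isDistinguishedAt_weierstrassDistinguished hreg).monic
    have : Module.Finite A (Polynomial A ⧸ Ideal.span {p.weierstrassDistinguished hreg}) :=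
      hmon.finite_quotient
    have : Module.Finite A S :=
      Module.Finite.equiv (p.algEquivQuotientWeierstrassDistinguished hreg).toLinearEquiv
    exact Algebra.IsIntegral.isIntegral _
  set μ := minpoly A (π H) with hμ
  have hmonic : μ.Monic := minpoly.monic hint
  -- apply the Hamiltonian derivation of `p` to the minimal equation of `H`
  let D : Derivation ℂ (PowerSeries A) (PowerSeries A) := dX A p • dCoeff d - dCoeff d p • dX A
  have hDap : ∀ f, D f = dX A p * dCoeff d f - dCoeff d p * dX A f := fun f => rfl
  have hDC : ∀ a, D (C a) = dX A p * C (d a) := fun a => by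
    rw [hDap, dX_C, dCoeff_C]; ring
  have hDp : D p = 0 := by rw [hDap]; ring
  have hDH : p ∣ D H := hJ
  have hpoly : p ∣ μ.sum fun i a => C a * H ^ i := by
    rw [← hπ]
    have := minpoly.aeval A (π H)
    rw [Polynomial.aeval_eq_sum_range] at this
    rw [Polynomial.sum_over_range _ (by simp), map_sum, ← this]
    refine Finset.sum_congr rfl fun i _ => ?_
    rw [map_mul, map_pow, Algebra.smul_def]
    rfl
  let ν : Polynomial A := ∑ i ∈ Finset.range μ.natDegree, Polynomial.monomial i (d (μ.coeff i))
  have hν : p ∣ ∑ i ∈ Finset.range μ.natDegree, C (d (μ.coeff i)) * H ^ i := by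
    have h1 : p ∣ D (μ.sum fun i a => C a * H ^ i) := by
      obtain ⟨g, hg⟩ := hpoly
      rw [hg, D.leibniz, hDp]
      simp
    rw [Polynomial.sum_over_range _ (by simp), map_sum, Finset.sum_range_succ,
      hmonic.coeff_natDegree] at h1
    have h2 : ∀ i a, p ∣ D (C a * H ^ i) - dX A p * (C (d a) * H ^ i) := by
      intro i a
      rw [D.leibniz, hDC, D.leibniz_pow]
      simp only [smul_eq_mul, nsmul_eq_mul]
      obtain ⟨g, hg⟩ := hDH
      exact ⟨C a * (i * (H ^ (i - 1) * g)), by rw [hg]; ring⟩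
    have h3 : p ∣ dX A p * ∑ i ∈ Finset.range μ.natDegree, C (d (μ.coeff i)) * H ^ i := by
      have h4 : p ∣ D (C 1 * H ^ μ.natDegree) := by simpa using h2 μ.natDegree 1
      have h5 := (dvd_add_left h4).1 h1
      have h6 := Finset.dvd_sum fun i (_ : i ∈ Finset.range μ.natDegree) => h2 i (μ.coeff i)
      rw [Finset.sum_sub_distrib] at h6
      rw [Finset.mul_sum]
      exact (dvd_sub_right h5).1 h6
    exact (hp.dvd_or_dvd h3).resolve_left hpX
  have hν0 : ν = 0 := by
    by_contra hne
    have h1 : Polynomial.aeval (π H) ν = 0 := by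
      rw [map_sum, ← (hπ _).2 hν, map_sum]
      refine Finset.sum_congr rfl fun i _ => ?_
      rw [Polynomial.aeval_monomial, map_mul, map_pow]
      rfl
    have h2 := minpoly.IsIntegrallyClosed.degree_le_of_ne_zero hne h1
    have h3 : ν.degree < μ.degree := by
      rw [Polynomial.degree_eq_natDegree hmonic.ne_zero]
      refine (Polynomial.degree_sum_le _ _).trans_lt ?_
      rw [Finset.sup_lt_iff (WithBot.bot_lt_coe _)]
      intro i hi
      exact (Polynomial.degree_monomial_le _ _).trans_lt
        (by exact_mod_cast Finset.mem_range.1 hi)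
    exact absurd h2 (not_le.2 h3)
  have hconst : ∀ i, ∃ z : ℂ, μ.coeff i = algebraMap ℂ A z := by
    intro i
    rcases lt_trichotomy i μ.natDegree with hi | hi | hi
    · apply hd
      have := congrArg (fun P => Polynomial.coeff P i) hν0
      simpa [ν, Polynomial.finsetSum_coeff, Polynomial.coeff_monomial, hi] using this
    · exact ⟨1, by rw [hi, hmonic.coeff_natDegree, map_one]⟩
    · exact ⟨0, by rw [Polynomial.coeff_eq_zero_of_natDegree_lt hi, map_zero]⟩
  obtain ⟨P, hP⟩ : ∃ P : Polynomial ℂ, P.map (algebraMap ℂ A) = μ :=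
    (Polynomial.mem_lifts μ).1 ((Polynomial.lifts_iff_coeff_lifts μ).2 fun i => by
      obtain ⟨z, hz⟩ := hconst i; exact ⟨z, hz.symm⟩)
  have hPm : P.Monic := by
    have hi : Function.Injective (algebraMap ℂ A) := (algebraMap ℂ A).injective
    exact Polynomial.monic_of_injective hi (hP ▸ hmonic)
  have hsplit := IsAlgClosed.splits P
  have hprod : p ∣ (P.roots.map fun z => H - C (algebraMap ℂ A z)).prod := by
    rw [← hπ]
    have h0 := minpoly.aeval A (π H)
    rw [← hμ, ← hP, hsplit.eq_prod_roots_of_monic hPm] at h0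
    rw [map_multiset_prod, Multiset.map_map, ← h0, Polynomial.map_multiset_prod, map_multiset_prod,
      Multiset.map_map, Multiset.map_map]
    congr 1
    refine Multiset.map_congr rfl fun z _ => ?_
    simp
    rfl
  obtain ⟨w, hw, hpw⟩ := hp.exists_mem_multiset_dvd hprod
  obtain ⟨z, -, rfl⟩ := Multiset.mem_map.1 hw
  rcases eq_or_ne z 0 with rfl | hz
  · simpa using hpw
  · exfalso
    have hu : IsUnit (C (algebraMap ℂ A z)) :=
      ((isUnit_iff_ne_zero.2 hz).map (algebraMap ℂ A)).map C
    refine hp.not_isUnit (isUnit_of_dvd_unit hpw ?_)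
    by_contra hnu
    have := (IsLocalRing.maximalIdeal (PowerSeries A)).sub_mem
      (show H ∈ IsLocalRing.maximalIdeal (PowerSeries A) from hH)
      (show H - C (algebraMap ℂ A z) ∈ IsLocalRing.maximalIdeal (PowerSeries A) from hnu)
    rw [sub_sub_cancel] at this
    exact this hu

end DifferentialCoefficients

section DiscreteValuationRing

variable {A : Type*} [CommRing A] [IsDomain A] [IsDiscreteValuationRing A] {ϖ : A}

theorem map_residue_eq_zero_iff (hϖ : Irreducible ϖ) (f : PowerSeries A) :
    f.map (IsLocalRing.residue A) = 0 ↔ C ϖ ∣ f := by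
  constructor
  · intro h
    have hc : ∀ i, ϖ ∣ coeff i f := by
      intro i
      have h1 := congrArg (coeff i) h
      rw [coeff_map, map_zero, IsLocalRing.residue_eq_zero_iff, hϖ.maximalIdeal_eq,
        Ideal.mem_span_singleton] at h1
      exact h1
    choose r hr using hc
    exact ⟨mk r, by ext1 i; rw [coeff_C_mul, coeff_mk, hr i]⟩
  · rintro ⟨r, rfl⟩
    have : IsLocalRing.residue A ϖ = 0 := by
      rw [IsLocalRing.residue_eq_zero_iff, hϖ.maximalIdeal_eq]
      exact Ideal.mem_span_singleton_self ϖ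
    rw [map_mul, map_C, this, map_zero, zero_mul]

theorem eq_zero_of_prime_dvd_C (hϖ : Irreducible ϖ) {p : PowerSeries A} (hp : Prime p)
    (hreg : p.map (IsLocalRing.residue A) ≠ 0) {a : A} (ha : p ∣ C a) : a = 0 := by
  by_contra ha0
  obtain ⟨N, u, rfl⟩ := IsDiscreteValuationRing.eq_unit_mul_pow_irreducible ha0 hϖ
  rw [map_mul, map_pow] at ha
  rcases hp.dvd_or_dvd ha with h | h
  · exact hp.not_isUnit (isUnit_of_dvd_unit h (u.isUnit.map C))
  · obtain ⟨r, hr⟩ := hp.dvd_of_dvd_pow h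
    have h1 := (map_residue_eq_zero_iff hϖ (C ϖ)).2 dvd_rfl
    rw [hr, map_mul] at h1
    obtain ⟨r', rfl⟩ := (map_residue_eq_zero_iff hϖ r).1 ((mul_eq_zero.1 h1).resolve_left hreg)
    have hC : (C ϖ : PowerSeries A) ≠ 0 := fun h0 => hϖ.ne_zero (C_injective (by rw [h0, map_zero]))
    refine hp.not_isUnit (IsUnit.of_mul_eq_one r' (mul_left_cancel₀ hC ?_))
    rw [mul_one, mul_left_comm, ← hr]

variable [Algebra ℂ A] {d : Derivation ℂ A A}

/-- If the ideal of `H` is preserved by a vector field transverse to `X`, and the coefficients of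
`H` up to order `n - 1` are not units, that of order `n - 1` being zero, then `X ^ n` divides
`H`. -/
theorem X_pow_dvd_of_invariant (hϖ : Irreducible ϖ) (hdϖ : ¬ϖ ∣ d ϖ) {H E K : PowerSeries A}
    (hrel : dCoeff d H = E * dX A H + K * H) {n : ℕ} (hlow : ∀ k < n, ϖ ∣ coeff k H)
    (hlast : ∀ k, k + 1 = n → coeff k H = 0) : X ^ n ∣ H := by
  rw [X_pow_dvd_iff]
  have key : ∀ N : ℕ, ∀ k < n, ϖ ^ N ∣ coeff k H := by
    intro N
    induction N with
    | zero => simp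
    | succ N ih =>
      intro k hk
      rcases eq_or_ne (coeff k H) 0 with h0 | h0
      · simp [h0]
      have hk1 : k + 1 < n := lt_of_le_of_ne hk fun h => h0 (hlast k h)
      have h1 : ϖ ^ N ∣ d (coeff k H) := by
        rw [← coeff_dCoeff, hrel, map_add, coeff_mul, coeff_mul]
        refine dvd_add (Finset.dvd_sum fun ij hij => ?_) (Finset.dvd_sum fun ij hij => ?_)
        · rw [coeff_dX]
          have := Finset.HasAntidiagonal.mem_antidiagonal.1 hij
          exact ((ih _ (by omega)).mul_right _).mul_left _
        · have := Finset.HasAntidiagonal.mem_antidiagonal.1 hij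
          exact (ih _ (by omega)).mul_left _
      have h2 := emultiplicity_derivation_add_one d hϖ.prime hdϖ (hlow k hk) h0
      rw [pow_dvd_iff_le_emultiplicity] at h1 ⊢
      rw [← h2]
      push_cast
      gcongr
  intro k hk
  by_contra h0
  obtain ⟨N, hN⟩ := FiniteMultiplicity.of_prime_left hϖ.prime h0
  exact hN (key _ k hk)

/-- The formal version of the extension theorem, for power series `q = b - i c` and `q' = b + i c`
with `∂_{\bar z} q = ∂_z H` and vanishing Jacobian `J[H, q q']`, in sheared coordinates. -/
theorem X_pow_dvd_of_jacobian_eq_zero [IsAdicComplete (IsLocalRing.maximalIdeal A) A]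
    (hd : ∀ a, d a = 0 → ∃ z : ℂ, a = algebraMap ℂ A z)
    (hϖ : Irreducible ϖ) (hdϖ : ¬ϖ ∣ d ϖ) {g : A} (hg : ϖ ∣ g)
    {D₂ : Derivation ℂ (PowerSeries A) (PowerSeries A)} (hD₂ : D₂ = dCoeff d - C g • dX A)
    {q q' H : PowerSeries A} (hpde : dX A q + Complex.I • D₂ q = dX A H - Complex.I • D₂ H)
    (hJ : dX A H * dCoeff d (q * q') = dCoeff d H * dX A (q * q'))
    {n : ℕ} (hn : n ≠ 0) {c : PowerSeries A} (hc : IsUnit c)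
    (hq : q - c * X ^ n ∈ IsLocalRing.maximalIdeal (PowerSeries A) ^ (n + 1))
    (hq' : q' - c * X ^ n ∈ IsLocalRing.maximalIdeal (PowerSeries A) ^ (n + 1))
    (hH : H - c * X ^ n ∈ IsLocalRing.maximalIdeal (PowerSeries A) ^ (n + 1))
    (hlow : ∀ k < n, ϖ ∣ coeff k H) (hlast : ∀ k, k + 1 = n → coeff k H = 0) :
    X ^ n ∣ q := by
  have hXm : (X : PowerSeries A) ∈ IsLocalRing.maximalIdeal (PowerSeries A) :=
    fun h => by simpa using h.map constantCoeff
  have hCϖ : ¬IsUnit (C ϖ : PowerSeries A) :=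
    fun h => hϖ.not_isUnit (by simpa using h.map constantCoeff)
  have hCg : (C g : PowerSeries A) ∈ IsLocalRing.maximalIdeal (PowerSeries A) := by
    obtain ⟨g', rfl⟩ := hg
    rw [map_mul]
    exact Ideal.mul_mem_right _ _ hCϖ
  have hD₂X : D₂ X = -C g := by
    rw [hD₂, Derivation.sub_apply, Derivation.smul_apply, dX_X, dCoeff_X]; simp
  have hunit_add : ∀ (u v : PowerSeries A), IsUnit u →
      v ∈ IsLocalRing.maximalIdeal (PowerSeries A) → IsUnit (u + v) := by
    intro u v hu hv
    by_contra h
    have h1 := (IsLocalRing.maximalIdeal (PowerSeries A)).sub_mem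
      (show u + v ∈ IsLocalRing.maximalIdeal (PowerSeries A) from h) hv
    rw [add_sub_cancel_right] at h1
    exact h1 hu
  have hDz : IsUnit ((dX A - Complex.I • D₂) X) := by
    rw [Derivation.sub_apply, Derivation.smul_apply, dX_X, hD₂X, sub_eq_add_neg]
    refine hunit_add _ _ isUnit_one ?_
    rw [smul_neg, neg_neg, Algebra.smul_def]
    exact Ideal.mul_mem_left _ _ hCg
  have hDzb : IsUnit ((dX A + Complex.I • D₂) X) := by
    rw [Derivation.add_apply, Derivation.smul_apply, dX_X, hD₂X]
    refine hunit_add _ _ isUnit_one ?_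
    rw [Algebra.smul_def]
    exact Ideal.mul_mem_left _ _ (neg_mem hCg)
  have hDX : IsUnit (dX A X) := by rw [dX_X]; exact isUnit_one
  have hne : ∀ f : PowerSeries A,
      f - c * X ^ n ∈ IsLocalRing.maximalIdeal (PowerSeries A) ^ (n + 1) → f ≠ 0 := by
    rintro f hf rfl
    have := isUnit_iterate_derivation (dX A) hXm hDX hc hf
    rw [iterate_map_zero] at this
    exact not_isUnit_zero this
  have hnd : ∀ (D : Derivation ℂ (PowerSeries A) (PowerSeries A)) (p : PowerSeries A),
      IsUnit (D X) → ¬IsUnit p → p ∣ q → ¬p ∣ D p := by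
    intro D p hD hp hpq h
    exact hp (isUnit_of_dvd_unit (dvd_iterate_derivation D h hpq n)
      (isUnit_iterate_derivation D hXm hD hc hq))
  have hqreg : q.map (IsLocalRing.residue A) ≠ 0 := by
    rw [Ne, map_residue_eq_zero_iff hϖ]
    intro h
    exact hnd (dX A) _ hDX hCϖ h (by rw [dX_C]; exact dvd_zero _)
  have hHu : ¬IsUnit H := by
    have h1 := (IsLocalRing.maximalIdeal (PowerSeries A)).add_mem
      (Ideal.pow_le_self n.succ_ne_zero hH)
      (Ideal.mul_mem_left _ c (Ideal.pow_mem_of_mem _ hXm n (Nat.pos_of_ne_zero hn)))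
    rwa [sub_add_cancel] at h1
  have hdvd : q ∣ H := by
    rw [UniqueFactorizationMonoid.dvd_iff_emultiplicity_le (hne q hq)]
    intro p hp
    by_cases hpq : p ∣ q
    swap
    · rw [emultiplicity_eq_zero.2 hpq]; exact zero_le
    have hpreg : p.map (IsLocalRing.residue A) ≠ 0 := by
      obtain ⟨r, rfl⟩ := hpq
      rw [map_mul] at hqreg
      exact left_ne_zero_of_mul hqreg
    have hpH : p ∣ H := by
      refine dvd_of_dvd_jacobian d hd hp hpreg (hnd _ p hDX hp.not_isUnit hpq)
        (fun a => eq_zero_of_prime_dvd_C hϖ hp hpreg) ?_ hHu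
      by_contra hcon
      let D : Derivation ℂ (PowerSeries A) (PowerSeries A) := dX A H • dCoeff d - dCoeff d H • dX A
      have hDp : ¬p ∣ D p := by
        have : D p = -(dX A p * dCoeff d H - dCoeff d p * dX A H) := by
          change dX A H * dCoeff d p - dCoeff d H * dX A p = _
          ring
        rwa [this, dvd_neg]
      have hf0 : q * q' ≠ 0 := mul_ne_zero (hne q hq) (hne q' hq')
      have h1 := emultiplicity_derivation_add_one D hp hDp (hpq.mul_right q') hf0
      have h2 : D (q * q') = 0 := sub_eq_zero.2 hJ
      rw [h2, emultiplicity_zero, top_add, eq_comm, emultiplicity_eq_top] at h1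
      exact h1 (FiniteMultiplicity.of_prime_left hp hf0)
    have h1 := emultiplicity_derivation_add_one _ hp
      (hnd _ p hDzb hp.not_isUnit hpq) hpq (hne q hq)
    have h2 := emultiplicity_derivation_add_one _ hp
      (hnd _ p hDz hp.not_isUnit hpq) hpH (hne H hH)
    rw [← h1, ← h2]
    exact le_of_eq (congrArg (fun f => emultiplicity p f + 1) hpde)
  obtain ⟨G, hG⟩ := hdvd
  have hG1 : G - 1 ∈ IsLocalRing.maximalIdeal (PowerSeries A) := by
    intro hu
    refine hne 0 ?_ rfl |>.elim
    have h1 : (0 : PowerSeries A) - c * (G - 1) * X ^ n ∈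
        IsLocalRing.maximalIdeal (PowerSeries A) ^ (n + 1) := by
      have := sub_mem (Ideal.mul_mem_right G _ hq) hH
      rw [hG] at this
      convert this using 1
      ring
    have := isUnit_iterate_derivation (dX A) hXm hDX (hc.mul hu) h1
    rw [iterate_map_zero] at this
    exact absurd this not_isUnit_zero
  have hGu : IsUnit G := by simpa using hunit_add 1 (G - 1) isUnit_one hG1
  have htwo : IsUnit (2 : PowerSeries A) := by
    have := (isUnit_iff_ne_zero.2 (two_ne_zero (α := ℂ))).map (algebraMap ℂ (PowerSeries A))
    rwa [map_ofNat] at this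
  have hG2 : IsUnit (1 + G) := by
    convert hunit_add 2 (G - 1) htwo hG1 using 1
    ring
  obtain ⟨W, hW⟩ := hG2.exists_right_inv
  let J : PowerSeries A := algebraMap ℂ (PowerSeries A) Complex.I
  have hJJ : J * J = -1 := by rw [← map_mul, Complex.I_mul_I, map_neg, map_one]
  have hrel : dCoeff d q = (J * W * (1 - G) + C g) * dX A q +
      (W * J * (-(dX A G - J * D₂ G))) * q := by
    have h1 : dX A q + J * D₂ q = dX A (q * G) - J * D₂ (q * G) := by
      rw [← hG, ← Algebra.smul_def, ← Algebra.smul_def]; exact hpde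
    have h2 : dCoeff d q = D₂ q + C g * dX A q := by
      rw [hD₂, Derivation.sub_apply, Derivation.smul_apply, smul_eq_mul]; ring
    rw [(dX A).leibniz, D₂.leibniz] at h1
    simp only [smul_eq_mul] at h1
    rw [h2]
    linear_combination (-J * W) * h1 + (D₂ q * (1 + G) * W) * hJJ - D₂ q * hW
  obtain ⟨V, hV⟩ := hGu.exists_right_inv
  have hqV : q = H * V := by rw [hG, mul_assoc, hV, mul_one]
  rw [hqV]
  refine (X_pow_dvd_of_invariant hϖ hdϖ (E := J * W * (1 - G) + C g)
    (K := V * (-(J * W * (1 - G) + C g) * dX A G +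
      G * (W * J * (-(dX A G - J * D₂ G))) + dCoeff d G)) ?_ hlow hlast).mul_right V
  rw [hG, (dX A).leibniz, (dCoeff d).leibniz, hrel]
  simp only [smul_eq_mul]
  linear_combination (-q * (-(J * W * (1 - G) + C g) * dX A G +
      G * (W * J * (-(dX A G - J * D₂ G))) + dCoeff d G)) * hV

end DiscreteValuationRing

section TwoVariables

/-- A power series in two variables all of whose terms have degree at least `n` lies in the `n`-th
power of the maximal ideal. -/
theorem mem_maximalIdeal_pow {n : ℕ} {F : PowerSeries (PowerSeries ℂ)}
    (hF : ∀ i j, i + j < n → coeff j (coeff i F) = 0) :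
    F ∈ IsLocalRing.maximalIdeal (PowerSeries (PowerSeries ℂ)) ^ n := by
  induction n generalizing F with
  | zero => simp
  | succ n ih =>
    rw [eq_X_mul_shift_add_const F]
    refine add_mem ?_ ?_
    · rw [pow_succ']
      refine Ideal.mul_mem_mul (fun h => by simpa using h.map constantCoeff) (ih fun i j hij => ?_)
      rw [coeff_mk]
      exact hF _ _ (by omega)
    · obtain ⟨r, hr⟩ := X_pow_dvd_iff.2 fun j (hj : j < n + 1) => hF 0 j (by omega)
      rw [coeff_zero_eq_constantCoeff_apply] at hr
      rw [hr, map_mul, map_pow]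
      refine Ideal.mul_mem_right _ _ (Ideal.pow_mem_pow (fun h => ?_) _)
      simpa using (h.map constantCoeff).map constantCoeff

instance isAdicComplete_maximalIdeal :
    IsAdicComplete (IsLocalRing.maximalIdeal (PowerSeries ℂ)) (PowerSeries ℂ) := by
  rw [maximalIdeal_eq_span_X]
  infer_instance

/-- The formal extension theorem for power series in two variables over `ℂ`. -/
theorem X_pow_dvd_of_jacobian_eq_zero_two_variables {g : PowerSeries ℂ}
    (hg : constantCoeff g = 0) {q q' H : PowerSeries (PowerSeries ℂ)}
    (hpde : dX _ q + Complex.I • (dCoeff (derivative ℂ) q - C g * dX _ q) =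
      dX _ H - Complex.I • (dCoeff (derivative ℂ) H - C g * dX _ H))
    (hJ : dX _ H * dCoeff (derivative ℂ) (q * q') = dCoeff (derivative ℂ) H * dX _ (q * q'))
    {n : ℕ} (hn : n ≠ 0) {κ : ℂ} (hκ : κ ≠ 0)
    (hq : ∀ i j, i + j < n + 1 → coeff j (coeff i (q - κ • X ^ n)) = 0)
    (hq' : ∀ i j, i + j < n + 1 → coeff j (coeff i (q' - κ • X ^ n)) = 0)
    (hH : ∀ i j, i + j < n + 1 → coeff j (coeff i (H - κ • X ^ n)) = 0)
    (hlast : ∀ k, k + 1 = n → coeff k H = 0) : X ^ n ∣ q := by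
  rw [Algebra.smul_def] at hq hq' hH
  refine X_pow_dvd_of_jacobian_eq_zero (d := derivative ℂ) (ϖ := X) (g := g) (fun a ha => ?_)
    X_irreducible ?_ (X_dvd_iff.2 hg) rfl hpde hJ hn ((isUnit_iff_ne_zero.2 hκ).map _)
    (mem_maximalIdeal_pow hq) (mem_maximalIdeal_pow hq') (mem_maximalIdeal_pow hH)
    (fun k hk => ?_) hlast
  · refine ⟨constantCoeff a, ?_⟩
    ext j
    rcases j with _ | j
    · simp
    · have := congrArg (coeff j) ha
      rw [coeff_derivative, map_zero, mul_eq_zero] at this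
      have h1 := this.resolve_right (by exact_mod_cast j.succ_ne_zero)
      simp [h1]
  · rw [derivative_X, X_dvd_iff]
    simp
  · rw [X_dvd_iff, ← coeff_zero_eq_constantCoeff_apply]
    have := hH k 0 (by omega)
    rw [map_sub, ← Algebra.smul_def] at this
    change coeff 0 (coeff k H - κ • coeff k (X ^ n)) = 0 at this
    rwa [coeff_X_pow, if_neg hk.ne, smul_zero, sub_zero] at this

end TwoVariables

end PowerSeries

/-! ### Directional derivatives of analytic functions -/

section DirDeriv

variable {E : Type*} [NormedAddCommGroup E] [NormedSpace ℝ E]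

/-- The derivative of `f` in the direction `v`. -/
noncomputable def dirDeriv (v : E) (f : E → ℝ) (p : E) : ℝ := fderiv ℝ f p v

variable {f g : E → ℝ} {p v w : E}

theorem AnalyticAt.dirDeriv (hf : AnalyticAt ℝ f p) (v : E) : AnalyticAt ℝ (dirDeriv v f) p :=
  ((ContinuousLinearMap.apply ℝ ℝ v).analyticAt _).comp hf.fderiv

theorem AnalyticAt.iterate_dirDeriv (hf : AnalyticAt ℝ f p) (v : E) (k : ℕ) :
    AnalyticAt ℝ ((_root_.dirDeriv v)^[k] f) p := by
  induction k generalizing f with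
  | zero => exact hf
  | succ k ih => exact ih (hf.dirDeriv v)

theorem Filter.EventuallyEq.dirDeriv (h : f =ᶠ[𝓝 p] g) (v : E) :
    dirDeriv v f =ᶠ[𝓝 p] dirDeriv v g :=
  h.fderiv.fun_comp fun L => L v

theorem Filter.EventuallyEq.iterate_dirDeriv (h : f =ᶠ[𝓝 p] g) (v : E) (k : ℕ) :
    (_root_.dirDeriv v)^[k] f =ᶠ[𝓝 p] (_root_.dirDeriv v)^[k] g := by
  induction k generalizing f g with
  | zero => exact h
  | succ k ih => exact ih (h.dirDeriv v)

theorem dirDeriv_add (hf : DifferentiableAt ℝ f p) (hg : DifferentiableAt ℝ g p) :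
    dirDeriv v (f + g) p = dirDeriv v f p + dirDeriv v g p := by
  simp [dirDeriv, fderiv_add hf hg]

theorem dirDeriv_const_smul (hf : DifferentiableAt ℝ f p) (r : ℝ) :
    dirDeriv v (r • f) p = r * dirDeriv v f p := by
  simp [dirDeriv, fderiv_const_smul hf]

theorem dirDeriv_mul (hf : DifferentiableAt ℝ f p) (hg : DifferentiableAt ℝ g p) :
    dirDeriv v (f * g) p = dirDeriv v f p * g p + f p * dirDeriv v g p := by
  simp [dirDeriv, fderiv_mul hf hg]
  ring

theorem AnalyticAt.dirDeriv_add_eventuallyEq (hf : AnalyticAt ℝ f p) (hg : AnalyticAt ℝ g p) :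
    _root_.dirDeriv v (f + g) =ᶠ[𝓝 p] _root_.dirDeriv v f + _root_.dirDeriv v g := by
  filter_upwards [hf.eventually_analyticAt, hg.eventually_analyticAt] with q hf hg
  exact dirDeriv_add hf.differentiableAt hg.differentiableAt

theorem AnalyticAt.dirDeriv_const_smul_eventuallyEq (hf : AnalyticAt ℝ f p) (r : ℝ) :
    _root_.dirDeriv v (r • f) =ᶠ[𝓝 p] r • _root_.dirDeriv v f := by
  filter_upwards [hf.eventually_analyticAt] with q hf
  exact dirDeriv_const_smul hf.differentiableAt r

theorem AnalyticAt.dirDeriv_mul_eventuallyEq (hf : AnalyticAt ℝ f p) (hg : AnalyticAt ℝ g p) :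
    _root_.dirDeriv v (f * g) =ᶠ[𝓝 p] _root_.dirDeriv v f * g + f * _root_.dirDeriv v g := by
  filter_upwards [hf.eventually_analyticAt, hg.eventually_analyticAt] with q hf hg
  exact dirDeriv_mul hf.differentiableAt hg.differentiableAt

theorem AnalyticAt.dirDeriv_comm (hf : AnalyticAt ℝ f p) (v w : E) :
    _root_.dirDeriv v (_root_.dirDeriv w f) p = _root_.dirDeriv w (_root_.dirDeriv v f) p := by
  have hd : DifferentiableAt ℝ (fderiv ℝ f) p := hf.fderiv.differentiableAt
  have key : ∀ v w : E, _root_.dirDeriv v (_root_.dirDeriv w f) p = fderiv ℝ (fderiv ℝ f) p v w := by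
    intro v w
    have h1 : HasFDerivAt (_root_.dirDeriv w f) ((ContinuousLinearMap.apply ℝ ℝ w).comp
        (fderiv ℝ (fderiv ℝ f) p)) p :=
      (ContinuousLinearMap.apply ℝ ℝ w).hasFDerivAt.comp p hd.hasFDerivAt
    rw [_root_.dirDeriv, h1.fderiv]
    rfl
  rw [key, key]
  exact hf.contDiffAt.isSymmSndFDerivAt_of_omega v w

theorem AnalyticAt.dirDeriv_comm_eventuallyEq (hf : AnalyticAt ℝ f p) (v w : E) :
    _root_.dirDeriv v (_root_.dirDeriv w f) =ᶠ[𝓝 p]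
      _root_.dirDeriv w (_root_.dirDeriv v f) := by
  filter_upwards [hf.eventually_analyticAt] with q hf
  exact hf.dirDeriv_comm v w

theorem AnalyticAt.iterate_dirDeriv_comm (hf : AnalyticAt ℝ f p) (v w : E) (k : ℕ) :
    (_root_.dirDeriv v)^[k] (_root_.dirDeriv w f) =ᶠ[𝓝 p]
      _root_.dirDeriv w ((_root_.dirDeriv v)^[k] f) := by
  induction k generalizing f with
  | zero => rfl
  | succ k ih =>
    exact ((hf.dirDeriv_comm_eventuallyEq v w).iterate_dirDeriv v k).trans (ih (hf.dirDeriv v))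

theorem AnalyticAt.iterate_dirDeriv_add (hf : AnalyticAt ℝ f p) (hg : AnalyticAt ℝ g p) (v : E)
    (k : ℕ) : (_root_.dirDeriv v)^[k] (f + g) =ᶠ[𝓝 p]
      (_root_.dirDeriv v)^[k] f + (_root_.dirDeriv v)^[k] g := by
  induction k generalizing f g with
  | zero => rfl
  | succ k ih =>
    exact ((hf.dirDeriv_add_eventuallyEq hg).iterate_dirDeriv v k).trans
      (ih (hf.dirDeriv v) (hg.dirDeriv v))

theorem AnalyticAt.iterate_dirDeriv_const_smul (hf : AnalyticAt ℝ f p) (r : ℝ) (v : E)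
    (k : ℕ) : (_root_.dirDeriv v)^[k] (r • f) =ᶠ[𝓝 p] r • (_root_.dirDeriv v)^[k] f := by
  induction k generalizing f with
  | zero => rfl
  | succ k ih =>
    exact ((hf.dirDeriv_const_smul_eventuallyEq r).iterate_dirDeriv v k).trans
      (ih (hf.dirDeriv v))

/-- The derivatives of `f` along the line through `v` compute the derivatives of `t ↦ f (t v)`. -/
theorem AnalyticAt.iteratedDeriv_comp_smul (hf : AnalyticAt ℝ f 0) (v : E) (k : ℕ) :
    iteratedDeriv k (fun t : ℝ => f (t • v)) =ᶠ[𝓝 0]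
      fun t => (_root_.dirDeriv v)^[k] f (t • v) := by
  induction k generalizing f with
  | zero => simp
  | succ k ih =>
    have hcont : Filter.Tendsto (fun t : ℝ => t • v) (𝓝 0) (𝓝 0) := by
      have : Continuous fun t : ℝ => t • v := by fun_prop
      simpa using this.tendsto 0
    have h1 : deriv (fun t : ℝ => f (t • v)) =ᶠ[𝓝 0] fun t => _root_.dirDeriv v f (t • v) := by
      filter_upwards [hcont.eventually hf.eventually_analyticAt] with t ht
      have h2 : HasDerivAt (fun t : ℝ => t • v) v t := by
        simpa using (hasDerivAt_id t).smul_const v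
      exact (ht.differentiableAt.hasFDerivAt.comp_hasDerivAt t h2).deriv
    rw [iteratedDeriv_succ']
    refine Filter.EventuallyEq.trans ?_ (ih (hf.dirDeriv v))
    filter_upwards [h1.eventuallyEq_nhds] with t ht
    exact ht.iteratedDeriv_eq k

end DirDeriv

/-! ### Taylor expansion in the plane -/

section Jet

theorem pdx_eq_dirDeriv {f : ℝ × ℝ → ℝ} {p : ℝ × ℝ} (hf : DifferentiableAt ℝ f p) :
    pdx f p = dirDeriv (1, 0) f p := by
  have h : HasDerivAt (fun x : ℝ => (x, p.2)) ((1 : ℝ), (0 : ℝ)) p.1 :=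
    (hasDerivAt_id p.1).prodMk (hasDerivAt_const p.1 p.2)
  exact (hf.hasFDerivAt.comp_hasDerivAt p.1 h).deriv

theorem pdy_eq_dirDeriv {f : ℝ × ℝ → ℝ} {p : ℝ × ℝ} (hf : DifferentiableAt ℝ f p) :
    pdy f p = dirDeriv (0, 1) f p := by
  have h : HasDerivAt (fun y : ℝ => (p.1, y)) ((0 : ℝ), (1 : ℝ)) p.2 :=
    (hasDerivAt_const p.2 p.1).prodMk (hasDerivAt_id p.2)
  exact (hf.hasFDerivAt.comp_hasDerivAt p.2 h).deriv

theorem AnalyticAt.pdx_eventuallyEq {f : ℝ × ℝ → ℝ} {p : ℝ × ℝ} (hf : AnalyticAt ℝ f p) :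
    pdx f =ᶠ[𝓝 p] _root_.dirDeriv (1, 0) f := by
  filter_upwards [hf.eventually_analyticAt] with q hq
  exact pdx_eq_dirDeriv hq.differentiableAt

theorem AnalyticAt.pdy_eventuallyEq {f : ℝ × ℝ → ℝ} {p : ℝ × ℝ} (hf : AnalyticAt ℝ f p) :
    pdy f =ᶠ[𝓝 p] _root_.dirDeriv (0, 1) f := by
  filter_upwards [hf.eventually_analyticAt] with q hq
  exact pdy_eq_dirDeriv hq.differentiableAt

theorem dirDeriv_mk (f : ℝ × ℝ → ℝ) (a b : ℝ) :
    dirDeriv (a, b) f = a • dirDeriv (1, 0) f + b • dirDeriv (0, 1) f := by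
  ext p
  have : ((a, b) : ℝ × ℝ) = a • ((1 : ℝ), (0 : ℝ)) + b • ((0 : ℝ), (1 : ℝ)) := by simp
  rw [dirDeriv, this, map_add, map_smul, map_smul]
  rfl

/-- The mixed partial derivative `∂_x^i ∂_y^j f` at the origin. -/
noncomputable def jet (f : ℝ × ℝ → ℝ) (i j : ℕ) : ℝ :=
  (dirDeriv (0, 1))^[j] ((dirDeriv (1, 0))^[i] f) 0

variable {f g : ℝ × ℝ → ℝ}

theorem jet_zero_zero (f : ℝ × ℝ → ℝ) : jet f 0 0 = f 0 := rfl

theorem jet_congr (h : f =ᶠ[𝓝 0] g) (i j : ℕ) : jet f i j = jet g i j :=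
  ((h.iterate_dirDeriv _ i).iterate_dirDeriv _ j).eq_of_nhds

theorem jet_dirDeriv_fst (f : ℝ × ℝ → ℝ) (i j : ℕ) :
    jet (dirDeriv (1, 0) f) i j = jet f (i + 1) j := rfl

theorem jet_dirDeriv_snd (hf : AnalyticAt ℝ f 0) (i j : ℕ) :
    jet (dirDeriv (0, 1) f) i j = jet f i (j + 1) :=
  ((hf.iterate_dirDeriv_comm (1, 0) (0, 1) i).iterate_dirDeriv _ j).eq_of_nhds

theorem jet_add (hf : AnalyticAt ℝ f 0) (hg : AnalyticAt ℝ g 0) (i j : ℕ) :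
    jet (f + g) i j = jet f i j + jet g i j :=
  (((hf.iterate_dirDeriv_add hg _ i).iterate_dirDeriv _ j).trans
    ((hf.iterate_dirDeriv _ i).iterate_dirDeriv_add (hg.iterate_dirDeriv _ i) _ j)).eq_of_nhds

theorem jet_const_smul (hf : AnalyticAt ℝ f 0) (r : ℝ) (i j : ℕ) :
    jet (r • f) i j = r * jet f i j :=
  (((hf.iterate_dirDeriv_const_smul r _ i).iterate_dirDeriv _ j).trans
    ((hf.iterate_dirDeriv _ i).iterate_dirDeriv_const_smul r _ j)).eq_of_nhds

theorem iterate_dirDeriv_mk (hf : AnalyticAt ℝ f 0) (a b : ℝ) (k : ℕ) :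
    (dirDeriv (a, b))^[k] f 0 = ∑ ij ∈ Finset.HasAntidiagonal.antidiagonal k,
      (k.choose ij.1 : ℝ) * (a ^ ij.1 * b ^ ij.2 * jet f ij.1 ij.2) := by
  induction k generalizing f with
  | zero => simp [jet_zero_zero]
  | succ k ih =>
    rw [Finset.sum_antidiagonal_choose_succ_mul
      fun i j => a ^ i * b ^ j * jet f i j, Function.iterate_succ_apply, ih (hf.dirDeriv _)]
    have h1 := hf.dirDeriv (1, 0)
    have h2 := hf.dirDeriv (0, 1)
    rw [← Finset.sum_add_distrib]
    refine Finset.sum_congr rfl fun ij hij => ?_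
    rw [Nat.choose_symm_of_eq_add (Finset.HasAntidiagonal.mem_antidiagonal.1 hij).symm]
    rw [dirDeriv_mk, jet_add (h1.const_smul) (h2.const_smul), jet_const_smul h1,
      jet_const_smul h2, jet_dirDeriv_fst, jet_dirDeriv_snd hf]
    ring

/-- An analytic function which is `o(‖p‖ ^ N)` at the origin has vanishing Taylor coefficients up to
order `N`. -/
theorem jet_eq_zero_of_isLittleO (hf : AnalyticAt ℝ f 0) {N : ℕ}
    (ho : f =o[𝓝 0] fun p => ‖p‖ ^ N) {i j : ℕ} (hij : i + j ≤ N) : jet f i j = 0 := by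
  have hline : ∀ v : ℝ × ℝ, ∀ k ≤ N, (dirDeriv v)^[k] f 0 = 0 := by
    intro v k hk
    have hcont : Filter.Tendsto (fun t : ℝ => t • v) (𝓝 0) (𝓝 0) := by
      have : Continuous fun t : ℝ => t • v := by fun_prop
      simpa using this.tendsto 0
    have hφ : AnalyticAt ℝ (fun t : ℝ => f (t • v)) 0 := by
      refine AnalyticAt.fun_comp (g := f) (f := fun t : ℝ => t • v) (by simpa using hf) ?_
      fun_prop
    have hφo : (fun t : ℝ => f (t • v)) =o[𝓝 0] fun t : ℝ => t ^ N := by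
      refine (ho.comp_tendsto hcont).trans_isBigO ?_
      refine IsBigO.of_bound (‖v‖ ^ N) (Filter.Eventually.of_forall fun t => ?_)
      simp [norm_smul, mul_pow, mul_comm]
    have h0 : ((N : ℕ) : ℕ∞) < analyticOrderAt (fun t : ℝ => f (t • v)) 0 := by
      by_contra! hlt
      obtain ⟨m, hm⟩ := ENat.ne_top_iff_exists.1 (ne_top_of_le_ne_top (ENat.natCast_ne_top N) hlt)
      rw [← hm, Nat.cast_le] at hlt
      obtain ⟨g, hg, hg0, hfg⟩ := (hφ.analyticOrderAt_eq_natCast).1 hm.symm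
      refine hg0 ?_
      have h1 : (fun t : ℝ => t ^ m * g t) =o[𝓝 0] fun t : ℝ => t ^ m := by
        refine IsLittleO.trans_isBigO (hφo.congr' ?_ Filter.EventuallyEq.rfl) ?_
        · filter_upwards [hfg] with t ht
          simpa using ht
        · refine IsBigO.of_bound 1 ?_
          filter_upwards [Metric.closedBall_mem_nhds (0 : ℝ) one_pos] with t ht
          rw [norm_pow, norm_pow, one_mul]
          exact pow_le_pow_of_le_one (norm_nonneg t) (by simpa using ht) hlt
      have h2 : Filter.Tendsto g (𝓝[≠] 0) (𝓝 0) := by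
        refine (h1.tendsto_div_nhds_zero.mono_left nhdsWithin_le_nhds).congr' ?_
        filter_upwards [self_mem_nhdsWithin] with t ht
        exact mul_div_cancel_left₀ _ (pow_ne_zero m ht)
      exact tendsto_nhds_unique (hg.continuousAt.tendsto.mono_left nhdsWithin_le_nhds) h2
    have h1 := (natCast_le_analyticOrderAt_iff_iteratedDeriv_eq_zero hφ (n := N + 1)).1
      (by exact_mod_cast Order.add_one_le_of_lt h0) k (by omega)
    rw [(hf.iteratedDeriv_comp_smul v k).eq_of_nhds] at h1
    simpa using h1
  have hpoly : ∑ m ∈ Finset.range (i + j + 1),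
      Polynomial.monomial m (((i + j).choose m : ℝ) * jet f m (i + j - m)) = 0 := by
    refine Polynomial.funext fun t => ?_
    have := hline (t, 1) (i + j) hij
    rw [iterate_dirDeriv_mk hf, Finset.Nat.sum_antidiagonal_eq_sum_range_succ
      fun m l => (((i + j).choose m : ℝ) * (t ^ m * 1 ^ l * jet f m l))] at this
    rw [Polynomial.eval_finsetSum, Polynomial.eval_zero, ← this]
    refine Finset.sum_congr rfl fun m _ => ?_
    rw [Polynomial.eval_monomial]
    ring
  have h1 := congrArg (fun P => Polynomial.coeff P i) hpoly
  simp only [Polynomial.finsetSum_coeff, Polynomial.coeff_monomial, Polynomial.coeff_zero,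
    Finset.sum_ite_eq', Finset.mem_range] at h1
  rw [if_pos (by omega), add_tsub_cancel_left, mul_eq_zero] at h1
  exact h1.resolve_left (by exact_mod_cast (Nat.choose_pos (by omega)).ne')

end Jet

section Taylor

open PowerSeries (dX dCoeff derivative)

open scoped Nat

variable {f g : ℝ × ℝ → ℝ}

/-- The Taylor series of `f` at the origin, as a power series in `x` whose coefficients are power
series in `y`. -/
noncomputable def taylor (f : ℝ × ℝ → ℝ) : PowerSeries (PowerSeries ℂ) :=
  .mk fun i => .mk fun j => ((jet f i j / (i ! * j !) : ℝ) : ℂ)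

theorem coeff_coeff_taylor (f : ℝ × ℝ → ℝ) (i j : ℕ) :
    PowerSeries.coeff j (PowerSeries.coeff i (taylor f)) = ((jet f i j / (i ! * j !) : ℝ) : ℂ) := by
  simp [taylor]

theorem coeff_coeff_taylor_eq_zero {i j : ℕ} :
    PowerSeries.coeff j (PowerSeries.coeff i (taylor f)) = 0 ↔ jet f i j = 0 := by
  rw [coeff_coeff_taylor, Complex.ofReal_eq_zero, div_eq_zero_iff, or_iff_left]
  positivity

theorem taylor_congr (h : f =ᶠ[𝓝 0] g) : taylor f = taylor g := by
  ext i j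
  rw [coeff_coeff_taylor, coeff_coeff_taylor, jet_congr h]

theorem taylor_add (hf : AnalyticAt ℝ f 0) (hg : AnalyticAt ℝ g 0) :
    taylor (f + g) = taylor f + taylor g := by
  ext i j
  rw [map_add, map_add, coeff_coeff_taylor, coeff_coeff_taylor, coeff_coeff_taylor,
    jet_add hf hg]
  push_cast
  ring

theorem taylor_const_smul (hf : AnalyticAt ℝ f 0) (r : ℝ) :
    taylor (r • f) = (r : ℂ) • taylor f := by
  ext i j
  change _ = (r : ℂ) • PowerSeries.coeff j (PowerSeries.coeff i (taylor f))
  rw [coeff_coeff_taylor, coeff_coeff_taylor, jet_const_smul hf, smul_eq_mul]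
  push_cast
  ring

theorem taylor_dirDeriv_fst (f : ℝ × ℝ → ℝ) : taylor (dirDeriv (1, 0) f) = dX _ (taylor f) := by
  ext i j
  have : ((i : PowerSeries ℂ) + 1) = PowerSeries.C ((i : ℂ) + 1) := by simp
  rw [PowerSeries.coeff_dX, this, PowerSeries.coeff_mul_C, coeff_coeff_taylor, coeff_coeff_taylor,
    jet_dirDeriv_fst, Nat.factorial_succ]
  push_cast
  have : (i : ℂ) + 1 ≠ 0 := by exact_mod_cast i.succ_ne_zero
  field_simp

theorem taylor_dirDeriv_snd (hf : AnalyticAt ℝ f 0) :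
    taylor (dirDeriv (0, 1) f) = dCoeff (derivative ℂ) (taylor f) := by
  ext i j
  rw [PowerSeries.coeff_dCoeff, PowerSeries.coeff_derivative, coeff_coeff_taylor,
    coeff_coeff_taylor, jet_dirDeriv_snd hf, Nat.factorial_succ]
  push_cast
  have : (j : ℂ) + 1 ≠ 0 := by exact_mod_cast j.succ_ne_zero
  field_simp

theorem taylor_mul (hf : AnalyticAt ℝ f 0) (hg : AnalyticAt ℝ g 0) :
    taylor (f * g) = taylor f * taylor g := by
  have key : ∀ (i j : ℕ) (f g : ℝ × ℝ → ℝ), AnalyticAt ℝ f 0 → AnalyticAt ℝ g 0 →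
      PowerSeries.coeff j (PowerSeries.coeff i (taylor (f * g))) =
        PowerSeries.coeff j (PowerSeries.coeff i (taylor f * taylor g)) := by
    intro i
    induction i with
    | zero =>
      intro j
      induction j with
      | zero =>
        intro f g hf hg
        have h0 : ∀ f : ℝ × ℝ → ℝ,
            PowerSeries.constantCoeff (PowerSeries.constantCoeff (taylor f)) = (f 0 : ℂ) := by
          intro f
          simpa [jet_zero_zero] using coeff_coeff_taylor f 0 0
        simp [h0]
      | succ j ih =>
        intro f g hf hg
        have h : dCoeff (derivative ℂ) (taylor f * taylor g) =
            taylor f * taylor (dirDeriv (0, 1) g) + taylor g * taylor (dirDeriv (0, 1) f) := by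
          rw [(dCoeff _).leibniz, taylor_dirDeriv_snd hf, taylor_dirDeriv_snd hg]
          rfl
        have h' : dCoeff (derivative ℂ) (taylor (f * g)) = taylor (f * dirDeriv (0, 1) g) +
            taylor (g * dirDeriv (0, 1) f) := by
          rw [← taylor_dirDeriv_snd (hf.mul hg), taylor_congr (hf.dirDeriv_mul_eventuallyEq hg),
            taylor_add ((hf.dirDeriv _).mul hg) (hf.mul (hg.dirDeriv _)), add_comm, mul_comm g]
        have h1 := ih f _ hf (hg.dirDeriv (0, 1))
        have h2 := ih g _ hg (hf.dirDeriv (0, 1))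
        have h3 := congrArg₂ (· + ·) h1 h2
        simp only [← map_add] at h3
        rw [← h, ← h', PowerSeries.coeff_dCoeff, PowerSeries.coeff_dCoeff,
          PowerSeries.coeff_derivative, PowerSeries.coeff_derivative] at h3
        exact mul_right_cancel₀ (by exact_mod_cast j.succ_ne_zero) h3
    | succ i ih =>
      intro j f g hf hg
      have h : dX _ (taylor f * taylor g) =
          taylor f * taylor (dirDeriv (1, 0) g) + taylor g * taylor (dirDeriv (1, 0) f) := by
        rw [(dX _).leibniz, taylor_dirDeriv_fst, taylor_dirDeriv_fst]
        rfl
      have h' : dX _ (taylor (f * g)) = taylor (f * dirDeriv (1, 0) g) +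
          taylor (g * dirDeriv (1, 0) f) := by
        rw [← taylor_dirDeriv_fst, taylor_congr (hf.dirDeriv_mul_eventuallyEq hg),
          taylor_add ((hf.dirDeriv _).mul hg) (hf.mul (hg.dirDeriv _)), add_comm, mul_comm g]
      have h1 := ih j f _ hf (hg.dirDeriv (1, 0))
      have h2 := ih j g _ hg (hf.dirDeriv (1, 0))
      have h3 := congrArg₂ (· + ·) h1 h2
      simp only [← map_add] at h3
      have hC : ((i : PowerSeries ℂ) + 1) = PowerSeries.C ((i : ℂ) + 1) := by simp
      rw [← h, ← h', PowerSeries.coeff_dX, PowerSeries.coeff_dX, hC, PowerSeries.coeff_mul_C,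
        PowerSeries.coeff_mul_C] at h3
      exact mul_right_cancel₀ (by exact_mod_cast i.succ_ne_zero) h3
  ext i j
  exact key i j f g hf hg

theorem jet_const (r : ℝ) (i j : ℕ) : jet (fun _ => r) i j = if i = 0 ∧ j = 0 then r else 0 := by
  have h0 : ∀ (v : ℝ × ℝ) (r : ℝ), dirDeriv v (fun _ => r) = fun _ => 0 := by
    intro v r
    ext p
    simp [dirDeriv]
  have hiter : ∀ (v : ℝ × ℝ) (r : ℝ) (k : ℕ),
      (dirDeriv v)^[k] (fun _ => r) = fun _ => if k = 0 then r else 0 := by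
    intro v r k
    rcases k with _ | k
    · simp
    · rw [Function.iterate_succ_apply, h0, Function.iterate_fixed (h0 v 0)]
      simp
  rw [jet, hiter, hiter]
  by_cases hi : i = 0 <;> by_cases hj : j = 0 <;> simp [hi, hj]

theorem taylor_eq_C (h : dirDeriv (1, 0) f =ᶠ[𝓝 0] 0) :
    taylor f = PowerSeries.C (PowerSeries.coeff 0 (taylor f)) := by
  ext i j
  rcases i with _ | i
  · simp
  · rw [PowerSeries.coeff_C, if_neg i.succ_ne_zero, map_zero, coeff_coeff_taylor_eq_zero,
      ← jet_dirDeriv_fst, jet_congr h]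
    exact (jet_const 0 i j).trans (by simp)

theorem dirDeriv_fst (a b : ℝ) : dirDeriv (a, b) (Prod.fst : ℝ × ℝ → ℝ) = fun _ => a := by
  ext p
  rw [dirDeriv, fderiv_fst]
  rfl

theorem taylor_fst_pow (n : ℕ) : taylor (Prod.fst ^ n) = PowerSeries.X ^ n := by
  induction n with
  | zero =>
    ext i j
    rw [coeff_coeff_taylor, pow_zero, pow_zero,
      show (1 : ℝ × ℝ → ℝ) = fun _ => 1 from rfl, jet_const, PowerSeries.coeff_one]
    by_cases hi : i = 0 <;> by_cases hj : j = 0 <;> simp [hi, hj, PowerSeries.coeff_one]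
  | succ n ih =>
    have hX : taylor Prod.fst = PowerSeries.X := by
      ext i j
      rw [coeff_coeff_taylor, PowerSeries.coeff_X]
      rcases i with _ | i
      · rcases j with _ | j
        · simp [jet_zero_zero]
        · rw [← jet_dirDeriv_snd analyticAt_fst, dirDeriv_fst, jet_const]
          simp
      · rw [← jet_dirDeriv_fst, dirDeriv_fst, jet_const]
        by_cases hi : i = 0 <;> by_cases hj : j = 0 <;> simp [hi, hj, PowerSeries.coeff_one]
    rw [pow_succ, taylor_mul (analyticAt_fst.pow n) analyticAt_fst, ih, hX, pow_succ]

end Taylor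

/-! ### Order of vanishing at the origin -/

section VanishesTo

variable {f g : ℝ × ℝ → ℝ} {k l : ℕ}

/-- All the Taylor coefficients of `f` at the origin of order less than `k` vanish. -/
def VanishesTo (k : ℕ) (f : ℝ × ℝ → ℝ) : Prop := ∀ i j, i + j < k → jet f i j = 0

theorem VanishesTo.mono (hf : VanishesTo k f) (h : l ≤ k) : VanishesTo l f :=
  fun i j hij => hf i j (hij.trans_le h)

theorem VanishesTo.congr (hf : VanishesTo k f) (h : f =ᶠ[𝓝 0] g) : VanishesTo k g :=
  fun i j hij => by rw [← jet_congr h, hf i j hij]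

theorem VanishesTo.zero : VanishesTo 0 f := fun i j hij => absurd hij (by omega)

theorem VanishesTo.apply_zero (hf : VanishesTo k f) (hk : k ≠ 0) : f 0 = 0 :=
  hf 0 0 (by omega)

theorem VanishesTo.dirDeriv_fst (hf : VanishesTo (k + 1) f) : VanishesTo k (dirDeriv (1, 0) f) :=
  fun i j hij => hf (i + 1) j (by omega)

theorem VanishesTo.dirDeriv_snd (hf : VanishesTo (k + 1) f) (ha : AnalyticAt ℝ f 0) :
    VanishesTo k (dirDeriv (0, 1) f) :=
  fun i j hij => by rw [jet_dirDeriv_snd ha, hf i (j + 1) (by omega)]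

theorem vanishesTo_succ (ha : AnalyticAt ℝ f 0) (h0 : f 0 = 0)
    (h1 : VanishesTo k (dirDeriv (1, 0) f)) (h2 : VanishesTo k (dirDeriv (0, 1) f)) :
    VanishesTo (k + 1) f := by
  rintro (_ | i) (_ | j) hij
  · exact h0
  · rw [← jet_dirDeriv_snd ha, h2 0 j (by omega)]
  · rw [← jet_dirDeriv_fst, h1 i 0 (by omega)]
  · rw [← jet_dirDeriv_fst, h1 i (j + 1) (by omega)]

theorem VanishesTo.add (hf : VanishesTo k f) (hg : VanishesTo k g) (haf : AnalyticAt ℝ f 0)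
    (hag : AnalyticAt ℝ g 0) : VanishesTo k (f + g) :=
  fun i j hij => by rw [jet_add haf hag, hf i j hij, hg i j hij, add_zero]

theorem VanishesTo.const_smul (hf : VanishesTo k f) (haf : AnalyticAt ℝ f 0) (r : ℝ) :
    VanishesTo k (r • f) :=
  fun i j hij => by rw [jet_const_smul haf, hf i j hij, mul_zero]

theorem VanishesTo.mul (hf : VanishesTo k f) (hg : VanishesTo l g) (haf : AnalyticAt ℝ f 0)
    (hag : AnalyticAt ℝ g 0) : VanishesTo (k + l) (f * g) := by
  induction hN : k + l generalizing k l f g with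
  | zero => exact .zero
  | succ N ih =>
    have key : ∀ v : ℝ × ℝ, (∀ k f, VanishesTo (k + 1) f → AnalyticAt ℝ f 0 →
        VanishesTo k (dirDeriv v f)) → VanishesTo N (dirDeriv v (f * g)) := by
      intro v hv
      refine VanishesTo.congr ?_ (haf.dirDeriv_mul_eventuallyEq hag).symm
      refine VanishesTo.add ?_ ?_ ((haf.dirDeriv v).mul hag) (haf.mul (hag.dirDeriv v))
      · rcases k with _ | k
        · exact ih (VanishesTo.zero (f := dirDeriv v f)) (hg.mono (by omega : N ≤ l))
            (haf.dirDeriv v) hag (zero_add N)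
        · exact ih (hv k f hf haf) hg (haf.dirDeriv v) hag (by omega)
      · rcases l with _ | l
        · exact ih (hf.mono (by omega : N ≤ k)) (VanishesTo.zero (f := dirDeriv v g)) haf
            (hag.dirDeriv v) (add_zero N)
        · exact ih hf (hv l g hg hag) haf (hag.dirDeriv v) (by omega)
    refine vanishesTo_succ (haf.mul hag) ?_ (key _ fun k f h _ => h.dirDeriv_fst)
      (key _ fun k f h ha => h.dirDeriv_snd ha)
    rw [Pi.mul_apply]
    rcases k with _ | k
    · rw [hg.apply_zero (by omega), mul_zero]
    · rw [hf.apply_zero (by omega), zero_mul]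

theorem VanishesTo.pow (hf : VanishesTo 1 f) (haf : AnalyticAt ℝ f 0) (n : ℕ) :
    VanishesTo n (f ^ n) := by
  induction n with
  | zero => exact .zero
  | succ n ih => exact pow_succ f n ▸ ih.mul hf (haf.pow n) haf

theorem VanishesTo.add_pow_sub_pow (hf : VanishesTo 1 f) (haf : AnalyticAt ℝ f 0)
    (hg : VanishesTo 2 g) (hag : AnalyticAt ℝ g 0) (n : ℕ) :
    VanishesTo (n + 1) ((f + g) ^ n - f ^ n) := by
  induction n with
  | zero =>
    intro i j hij
    obtain ⟨rfl, rfl⟩ : i = 0 ∧ j = 0 := by omega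
    simp [jet_zero_zero]
  | succ n ih =>
    have h1 : (f + g) ^ (n + 1) - f ^ (n + 1) =
        ((f + g) ^ n - f ^ n) * (f + g) + f ^ n * g := by ring
    rw [h1]
    have h2 := (haf.add hag).pow n |>.sub (haf.pow n)
    exact (ih.mul (hf.add (hg.mono one_le_two) haf hag) h2 (haf.add hag)).add
      ((hf.pow haf n).mul hg (haf.pow n) hag) (h2.mul (haf.add hag)) ((haf.pow n).mul hag)

end VanishesTo

/-! ### Shears -/

section Shear

/-- The shear `(x, y) ↦ (x + γ y, y)`. -/
def shear (γ : ℝ → ℝ) (p : ℝ × ℝ) : ℝ × ℝ := (p.1 + γ p.2, p.2)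

variable {γ : ℝ → ℝ} {f : ℝ × ℝ → ℝ}

theorem shear_zero (h0 : γ 0 = 0) : shear γ 0 = 0 := by simp [shear, h0]

theorem analyticAt_comp_snd (hγ : AnalyticAt ℝ γ 0) :
    AnalyticAt ℝ (fun p : ℝ × ℝ => γ p.2) 0 :=
  AnalyticAt.fun_comp (g := γ) (f := Prod.snd) hγ analyticAt_snd

theorem analyticAt_shear (hγ : AnalyticAt ℝ γ 0) : AnalyticAt ℝ (shear γ) 0 :=
  (analyticAt_fst.add (analyticAt_comp_snd hγ)).prod analyticAt_snd

theorem AnalyticAt.comp_shear (hf : AnalyticAt ℝ f 0) (hγ : AnalyticAt ℝ γ 0) (h0 : γ 0 = 0) :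
    AnalyticAt ℝ (f ∘ shear γ) 0 :=
  AnalyticAt.comp (by rwa [shear_zero h0]) (analyticAt_shear hγ)

theorem tendsto_shear (hγ : AnalyticAt ℝ γ 0) (h0 : γ 0 = 0) :
    Filter.Tendsto (shear γ) (𝓝 0) (𝓝 0) := by
  simpa [shear_zero h0] using (analyticAt_shear hγ).continuousAt.tendsto

theorem dirDeriv_comp_snd (hγ : AnalyticAt ℝ γ 0) (a b : ℝ) :
    dirDeriv (a, b) (fun p : ℝ × ℝ => γ p.2) =ᶠ[𝓝 0] fun p => b * deriv γ p.2 := by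
  have : Filter.Tendsto (Prod.snd : ℝ × ℝ → ℝ) (𝓝 0) (𝓝 0) := continuous_snd.tendsto 0
  filter_upwards [this.eventually hγ.eventually_analyticAt] with p hp
  have h : HasFDerivAt (fun p : ℝ × ℝ => γ p.2) _ p :=
    hp.differentiableAt.hasDerivAt.comp_hasFDerivAt p (hasFDerivAt_snd (𝕜 := ℝ))
  rw [dirDeriv, h.fderiv]
  simp [mul_comm]

theorem dirDeriv_comp_shear (hf : AnalyticAt ℝ f 0) (hγ : AnalyticAt ℝ γ 0) (h0 : γ 0 = 0)
    (a b : ℝ) : dirDeriv (a, b) (f ∘ shear γ) =ᶠ[𝓝 0]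
      fun p => (a + b * deriv γ p.2) * dirDeriv (1, 0) f (shear γ p) +
        b * dirDeriv (0, 1) f (shear γ p) := by
  filter_upwards [(tendsto_shear hγ h0).eventually hf.eventually_analyticAt,
    (analyticAt_comp_snd hγ).eventually_analyticAt, dirDeriv_comp_snd hγ a b] with p hp hγp hd
  have h : HasFDerivAt (shear γ) _ p :=
    ((hasFDerivAt_fst (𝕜 := ℝ)).add hγp.differentiableAt.hasFDerivAt).prodMk hasFDerivAt_snd
  rw [dirDeriv, (hp.differentiableAt.hasFDerivAt.comp p h).fderiv]
  have h2 := congrFun (dirDeriv_mk f (a + b * deriv γ p.2) b) (shear γ p)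
  simp only [dirDeriv, Pi.add_apply, Pi.smul_apply, smul_eq_mul] at h2 hd ⊢
  rw [← h2, ← hd]
  rfl

theorem dirDeriv_fst_comp_shear (hf : AnalyticAt ℝ f 0) (hγ : AnalyticAt ℝ γ 0) (h0 : γ 0 = 0) :
    dirDeriv (1, 0) (f ∘ shear γ) =ᶠ[𝓝 0] dirDeriv (1, 0) f ∘ shear γ := by
  filter_upwards [dirDeriv_comp_shear hf hγ h0 1 0] with p hp
  simp [hp]

theorem dirDeriv_snd_comp_shear (hf : AnalyticAt ℝ f 0) (hγ : AnalyticAt ℝ γ 0) (h0 : γ 0 = 0) :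
    dirDeriv (0, 1) (f ∘ shear γ) =ᶠ[𝓝 0] dirDeriv (0, 1) f ∘ shear γ +
      (dirDeriv (1, 0) f ∘ shear γ) * fun p => deriv γ p.2 := by
  filter_upwards [dirDeriv_comp_shear hf hγ h0 0 1] with p hp
  simp only [hp, Pi.add_apply, Pi.mul_apply, Function.comp]
  ring

theorem VanishesTo.comp_shear {k : ℕ} (h : VanishesTo k f) (hf : AnalyticAt ℝ f 0)
    (hγ : AnalyticAt ℝ γ 0) (h0 : γ 0 = 0) : VanishesTo k (f ∘ shear γ) := by
  induction k generalizing f with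
  | zero => exact .zero
  | succ k ih =>
    have h1 := ih h.dirDeriv_fst (hf.dirDeriv _)
    have ha1 := (hf.dirDeriv (1, 0)).comp_shear hγ h0
    have hγ' := analyticAt_comp_snd hγ.deriv
    refine vanishesTo_succ (hf.comp_shear hγ h0) ?_
      (h1.congr (dirDeriv_fst_comp_shear hf hγ h0).symm)
      (VanishesTo.congr ?_ (dirDeriv_snd_comp_shear hf hγ h0).symm)
    · rw [Function.comp, shear_zero h0, h.apply_zero k.succ_ne_zero]
    · exact (ih (h.dirDeriv_snd hf) (hf.dirDeriv _)).add (h1.mul .zero ha1 hγ')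
        ((hf.dirDeriv _).comp_shear hγ h0) (ha1.mul hγ')

end Shear

section Formal

open PowerSeries (dX dCoeff derivative)

theorem jet_zero_eq_iteratedDeriv {f : ℝ × ℝ → ℝ} (hf : AnalyticAt ℝ f 0) (j : ℕ) :
    jet f 0 j = iteratedDeriv j (fun t => f (0, t)) 0 := by
  have := (hf.iteratedDeriv_comp_smul (0, 1) j).eq_of_nhds
  simp only [Prod.smul_mk, smul_eq_mul, mul_zero, mul_one, zero_smul] at this
  exact this.symm

theorem iterate_dirDeriv_fst_comp_shear {f : ℝ × ℝ → ℝ} {γ : ℝ → ℝ} (hf : AnalyticAt ℝ f 0)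
    (hγ : AnalyticAt ℝ γ 0) (h0 : γ 0 = 0) (k : ℕ) :
    (dirDeriv (1, 0))^[k] (f ∘ shear γ) =ᶠ[𝓝 0] (dirDeriv (1, 0))^[k] f ∘ shear γ := by
  induction k generalizing f with
  | zero => rfl
  | succ k ih =>
    exact ((dirDeriv_fst_comp_shear hf hγ h0).iterate_dirDeriv _ k).trans (ih (hf.dirDeriv _))

theorem VanishesTo.add_smul_fst_pow_comp_shear {f : ℝ × ℝ → ℝ} {γ : ℝ → ℝ} {n : ℕ} {κ : ℝ}
    (hfo : VanishesTo (n + 1) (f + (-κ) • Prod.fst ^ n)) (hf : AnalyticAt ℝ f 0)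
    (hγ : AnalyticAt ℝ γ 0) (h0 : γ 0 = 0) (h0' : deriv γ 0 = 0) :
    VanishesTo (n + 1) (f ∘ shear γ + (-κ) • Prod.fst ^ n) := by
  have hfst : AnalyticAt ℝ (Prod.fst : ℝ × ℝ → ℝ) 0 := analyticAt_fst
  have hv1 : VanishesTo 1 (Prod.fst : ℝ × ℝ → ℝ) := by
    intro i j hij
    obtain ⟨rfl, rfl⟩ : i = 0 ∧ j = 0 := by omega
    rfl
  have hv2 : VanishesTo 2 (fun p : ℝ × ℝ => γ p.2) := by
    refine vanishesTo_succ (analyticAt_comp_snd hγ) h0 ?_ ?_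
    · intro i j hij
      obtain ⟨rfl, rfl⟩ : i = 0 ∧ j = 0 := by omega
      simpa [jet_zero_zero] using (dirDeriv_comp_snd hγ 1 0).eq_of_nhds
    · intro i j hij
      obtain ⟨rfl, rfl⟩ : i = 0 ∧ j = 0 := by omega
      simpa [jet_zero_zero, h0'] using (dirDeriv_comp_snd hγ 0 1).eq_of_nhds
  have hpow := (hfst.pow n).const_smul (c := -κ)
  have hsum := (hfst.add (analyticAt_comp_snd hγ)).pow n
  have h1 := (hfo.comp_shear (hf.add hpow) hγ h0).add
    ((hv1.add_pow_sub_pow hfst hv2 (analyticAt_comp_snd hγ) n).const_smul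
      (hsum.sub (hfst.pow _)) κ) ((hf.add hpow).comp_shear hγ h0)
    ((hsum.sub (hfst.pow _)).const_smul)
  have h2 : f ∘ shear γ + (-κ) • Prod.fst ^ n =
      (f + (-κ) • Prod.fst ^ n) ∘ shear γ +
      κ • ((Prod.fst + fun p : ℝ × ℝ => γ p.2) ^ n - Prod.fst ^ n) := by
    ext p
    simp only [Pi.add_apply, Pi.smul_apply, Pi.pow_apply, Pi.sub_apply, Function.comp, shear,
      smul_eq_mul]
    ring
  rw [h2]
  exact h1

/-- Let `h`, `b`, `c` be half the Laplacian and the entries of the traceless part of a Hessian, with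
leading terms `κ x ^ (m + 1)`, `κ x ^ (m + 1)` and `0`. If `J[h, b ^ 2 + c ^ 2]` vanishes, then `b`
and `c` vanish to order `m + 1` along any curve `x = γ y` on which `∂_x ^ m h` vanishes. -/
theorem jet_comp_shear_eq_zero {b c h : ℝ × ℝ → ℝ} {γ : ℝ → ℝ} {m : ℕ} {κ : ℝ}
    (hb : AnalyticAt ℝ b 0) (hc : AnalyticAt ℝ c 0) (hh : AnalyticAt ℝ h 0)
    (hx : dirDeriv (1, 0) h =ᶠ[𝓝 0] dirDeriv (1, 0) b + dirDeriv (0, 1) c)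
    (hy : dirDeriv (1, 0) c =ᶠ[𝓝 0] dirDeriv (0, 1) h + dirDeriv (0, 1) b)
    (hJ : dirDeriv (1, 0) h * dirDeriv (0, 1) (b * b + c * c) =ᶠ[𝓝 0]
      dirDeriv (0, 1) h * dirDeriv (1, 0) (b * b + c * c))
    (hκ : κ ≠ 0) (hbo : VanishesTo (m + 2) (b + (-κ) • Prod.fst ^ (m + 1)))
    (hco : VanishesTo (m + 2) c) (hho : VanishesTo (m + 2) (h + (-κ) • Prod.fst ^ (m + 1)))
    (hγ : AnalyticAt ℝ γ 0) (h0 : γ 0 = 0) (h0' : deriv γ 0 = 0)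
    (hγh : ∀ᶠ y in 𝓝 0, (dirDeriv (1, 0))^[m] h (γ y, y) = 0) {i : ℕ} (hi : i < m + 1) (j : ℕ) :
    jet (b ∘ shear γ) i j = 0 ∧ jet (c ∘ shear γ) i j = 0 := by
  have hb' := hb.comp_shear hγ h0
  have hc' := hc.comp_shear hγ h0
  have hh' := hh.comp_shear hγ h0
  have htan := tendsto_shear hγ h0
  have hsnd := analyticAt_comp_snd hγ.deriv
  obtain ⟨g, hg⟩ : ∃ g, taylor (fun p => deriv γ p.2) = PowerSeries.C g := by
    refine ⟨_, taylor_eq_C ?_⟩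
    filter_upwards [dirDeriv_comp_snd hγ.deriv 1 0] with p hp
    simpa using hp
  have hg0 : PowerSeries.constantCoeff g = 0 := by
    have : PowerSeries.coeff 0 (PowerSeries.coeff 0 (taylor fun p => deriv γ p.2)) = 0 :=
      coeff_coeff_taylor_eq_zero.2 h0'
    rw [hg] at this
    simpa using this
  have hd1 : ∀ f, AnalyticAt ℝ f 0 →
      taylor (dirDeriv (1, 0) f ∘ shear γ) = dX _ (taylor (f ∘ shear γ)) := by
    intro f hf
    rw [← taylor_dirDeriv_fst, taylor_congr (dirDeriv_fst_comp_shear hf hγ h0)]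
  have hd2 : ∀ f, AnalyticAt ℝ f 0 → taylor (dirDeriv (0, 1) f ∘ shear γ) =
      dCoeff (derivative ℂ) (taylor (f ∘ shear γ)) -
        PowerSeries.C g * dX _ (taylor (f ∘ shear γ)) := by
    intro f hf
    have h1 := (hf.dirDeriv (1, 0)).comp_shear hγ h0
    rw [← taylor_dirDeriv_snd (hf.comp_shear hγ h0),
      taylor_congr (dirDeriv_snd_comp_shear hf hγ h0),
      taylor_add ((hf.dirDeriv _).comp_shear hγ h0) (h1.mul hsnd), taylor_mul h1 hsnd, hg, hd1 f hf]
    ring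
  have hcong : ∀ {f₁ f₂ : ℝ × ℝ → ℝ}, f₁ =ᶠ[𝓝 0] f₂ →
      taylor (f₁ ∘ shear γ) = taylor (f₂ ∘ shear γ) :=
    fun h => taylor_congr (h.comp_tendsto htan)
  have hX : dX _ (taylor (h ∘ shear γ)) = dX _ (taylor (b ∘ shear γ)) +
      (dCoeff (derivative ℂ) (taylor (c ∘ shear γ)) -
        PowerSeries.C g * dX _ (taylor (c ∘ shear γ))) := by
    rw [← hd1 h hh, ← hd1 b hb, ← hd2 c hc, hcong hx]
    exact taylor_add ((hb.dirDeriv _).comp_shear hγ h0) ((hc.dirDeriv _).comp_shear hγ h0)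
  have hY : dX _ (taylor (c ∘ shear γ)) = (dCoeff (derivative ℂ) (taylor (h ∘ shear γ)) -
      PowerSeries.C g * dX _ (taylor (h ∘ shear γ))) +
      (dCoeff (derivative ℂ) (taylor (b ∘ shear γ)) -
        PowerSeries.C g * dX _ (taylor (b ∘ shear γ))) := by
    rw [← hd1 c hc, ← hd2 b hb, ← hd2 h hh, hcong hy]
    exact taylor_add ((hh.dirDeriv _).comp_shear hγ h0) ((hb.dirDeriv _).comp_shear hγ h0)
  have hr := (hb.mul hb).add (hc.mul hc)
  have hR : taylor ((b * b + c * c) ∘ shear γ) = taylor (b ∘ shear γ) * taylor (b ∘ shear γ) +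
      taylor (c ∘ shear γ) * taylor (c ∘ shear γ) := by
    rw [← taylor_mul hb' hb', ← taylor_mul hc' hc']
    exact taylor_add (hb'.mul hb') (hc'.mul hc')
  have hJ' : dX _ (taylor (h ∘ shear γ)) *
      dCoeff (derivative ℂ) (taylor ((b * b + c * c) ∘ shear γ)) =
      dCoeff (derivative ℂ) (taylor (h ∘ shear γ)) *
      dX _ (taylor ((b * b + c * c) ∘ shear γ)) := by
    have h1 := hcong hJ
    have h2 : ∀ f₁ f₂ : ℝ × ℝ → ℝ, AnalyticAt ℝ f₁ 0 → AnalyticAt ℝ f₂ 0 →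
        taylor ((f₁ * f₂) ∘ shear γ) = taylor (f₁ ∘ shear γ) * taylor (f₂ ∘ shear γ) :=
      fun f₁ f₂ hf₁ hf₂ => taylor_mul (hf₁.comp_shear hγ h0) (hf₂.comp_shear hγ h0)
    rw [h2 _ _ (hh.dirDeriv _) (hr.dirDeriv _), h2 _ _ (hh.dirDeriv _) (hr.dirDeriv _),
      hd1 h hh, hd2 h hh, hd1 _ hr, hd2 _ hr] at h1
    linear_combination h1
  let J : PowerSeries (PowerSeries ℂ) := algebraMap ℂ _ Complex.I
  have hJJ : J * J = -1 := by rw [← map_mul, Complex.I_mul_I, map_neg, map_one]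
  have hfst : AnalyticAt ℝ (Prod.fst : ℝ × ℝ → ℝ) 0 := analyticAt_fst
  have hlead : ∀ f, AnalyticAt ℝ f 0 → VanishesTo (m + 2) (f + (-κ) • Prod.fst ^ (m + 1)) →
      ∀ i j, i + j < m + 1 + 1 → PowerSeries.coeff j (PowerSeries.coeff i
        (taylor (f ∘ shear γ) - (κ : ℂ) • PowerSeries.X ^ (m + 1))) = 0 := by
    intro f hf hfo i j hij
    have h1 := hfo.add_smul_fst_pow_comp_shear hf hγ h0 h0'
    have hpow := (hfst.pow (m + 1)).const_smul (c := -κ)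
    have h3 := coeff_coeff_taylor_eq_zero.2 (h1 i j hij)
    rwa [taylor_add (hf.comp_shear hγ h0) hpow, taylor_const_smul (hfst.pow _), taylor_fst_pow,
      Complex.ofReal_neg, neg_smul, ← sub_eq_add_neg] at h3
  have hlast : ∀ k, k + 1 = m + 1 → PowerSeries.coeff k (taylor (h ∘ shear γ)) = 0 := by
    intro k hk
    obtain rfl : k = m := by omega
    ext j
    rw [map_zero, coeff_coeff_taylor_eq_zero]
    have h1 : jet (h ∘ shear γ) k j = jet ((dirDeriv (1, 0))^[k] h ∘ shear γ) 0 j :=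
      ((iterate_dirDeriv_fst_comp_shear hh hγ h0 k).iterate_dirDeriv _ j).eq_of_nhds
    rw [h1, jet_zero_eq_iteratedDeriv ((hh.iterate_dirDeriv _ k).comp_shear hγ h0)]
    have h2 : (fun t => ((dirDeriv (1, 0))^[k] h ∘ shear γ) (0, t)) =ᶠ[𝓝 0] fun _ => 0 := by
      filter_upwards [hγh] with t ht
      simpa [shear] using ht
    rw [h2.iteratedDeriv_eq, iteratedDeriv_const]
    simp
  have hcoeffc : ∀ i j, i + j < m + 1 + 1 →
      PowerSeries.coeff j (PowerSeries.coeff i (taylor (c ∘ shear γ))) = 0 := fun i j hij =>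
    coeff_coeff_taylor_eq_zero.2 (hco.comp_shear hc hγ h0 i j hij)
  have hcsmul : ∀ (z : ℂ) (i j : ℕ), PowerSeries.coeff j (PowerSeries.coeff i
      (z • taylor (c ∘ shear γ))) =
      z * PowerSeries.coeff j (PowerSeries.coeff i (taylor (c ∘ shear γ))) :=
    fun z i j => rfl
  have hdvd := PowerSeries.X_pow_dvd_of_jacobian_eq_zero_two_variables hg0
    (q := taylor (b ∘ shear γ) - Complex.I • taylor (c ∘ shear γ))
    (q' := taylor (b ∘ shear γ) + Complex.I • taylor (c ∘ shear γ))
    (H := taylor (h ∘ shear γ)) ?_ ?_ m.succ_ne_zero (Complex.ofReal_ne_zero.2 hκ) ?_ ?_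
    (hlead h hh hho) hlast
  · have h1 := PowerSeries.X_pow_dvd_iff.1 hdvd i hi
    have h2 := congrArg (PowerSeries.coeff j) h1
    rw [map_sub, map_sub, hcsmul, map_zero] at h2
    rw [← coeff_coeff_taylor_eq_zero, ← coeff_coeff_taylor_eq_zero]
    rw [coeff_coeff_taylor, coeff_coeff_taylor] at h2 ⊢
    have hre := congrArg Complex.re h2
    have him := congrArg Complex.im h2
    simp only [Complex.sub_re, Complex.sub_im, Complex.ofReal_re, Complex.ofReal_im,
      Complex.mul_re, Complex.mul_im, Complex.I_re, Complex.I_im, Complex.zero_re,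
      Complex.zero_im] at hre him
    exact ⟨by rw [Complex.ofReal_eq_zero]; linarith, by rw [Complex.ofReal_eq_zero]; linarith⟩
  · have h1 : ∀ D : Derivation ℂ (PowerSeries (PowerSeries ℂ)) (PowerSeries (PowerSeries ℂ)),
        D (taylor (b ∘ shear γ) - Complex.I • taylor (c ∘ shear γ)) =
          D (taylor (b ∘ shear γ)) - J * D (taylor (c ∘ shear γ)) := by
      intro D
      rw [map_sub, D.map_smul, Algebra.smul_def]
    rw [h1, h1, Algebra.smul_def, Algebra.smul_def]
    linear_combination -hX - J * hY - (dCoeff (derivative ℂ) (taylor (c ∘ shear γ)) -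
      PowerSeries.C g * dX _ (taylor (c ∘ shear γ))) * hJJ
  · have h1 : (taylor (b ∘ shear γ) - Complex.I • taylor (c ∘ shear γ)) *
        (taylor (b ∘ shear γ) + Complex.I • taylor (c ∘ shear γ)) =
        taylor ((b * b + c * c) ∘ shear γ) := by
      rw [hR, Algebra.smul_def]
      linear_combination -(taylor (c ∘ shear γ)) ^ 2 * hJJ
    rw [h1, hJ']
  · intro i j hij
    have := hlead b hb hbo i j hij
    rw [sub_right_comm, map_sub, map_sub, this, hcsmul, hcoeffc i j hij]
    simp
  · intro i j hij
    have := hlead b hb hbo i j hij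
    rw [add_sub_right_comm, map_add, map_add, this, hcsmul, hcoeffc i j hij]
    simp

end Formal

set_option maxHeartbeats 400000 in
/-- An integral of analytic functions `z ↦ k (T t z)` with contractions `T t` is analytic. -/
theorem AnalyticAt.intervalIntegral_comp_clm {E : Type*} [NormedAddCommGroup E] [NormedSpace ℝ E]
    {k : E → ℝ} (hk : AnalyticAt ℝ k 0) {T : ℝ → E →L[ℝ] E} (hT : Continuous T)
    (hT1 : ∀ t ∈ Icc (0 : ℝ) 1, ‖T t‖ ≤ 1) :
    AnalyticAt ℝ (fun z => ∫ t in (0 : ℝ)..1, k (T t z)) 0 := by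
  obtain ⟨p, r, hp⟩ := hk
  have huI : ∀ t ∈ Set.uIoc (0 : ℝ) 1, ‖T t‖ ≤ 1 := fun t ht => by
    rw [Set.uIoc_of_le zero_le_one] at ht
    exact hT1 t ⟨ht.1.le, ht.2⟩
  have hcont (n : ℕ) : Continuous fun t => (p n).compContinuousLinearMap fun _ => T t := by
    have h := (ContinuousMultilinearMap.compContinuousLinearMapContinuousMultilinear ℝ
      (fun _ : Fin n => E) (fun _ => E) ℝ).cont
    exact (h.comp (continuous_pi fun _ => hT)).clm_apply continuous_const
  let q : FormalMultilinearSeries ℝ E ℝ := fun n =>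
    ∫ t in (0 : ℝ)..1, (p n).compContinuousLinearMap fun _ => T t
  have hq (n : ℕ) : ‖q n‖ ≤ ‖p n‖ := by
    have := intervalIntegral.norm_integral_le_of_norm_le_const (a := (0 : ℝ)) (b := 1)
      (f := fun t => (p n).compContinuousLinearMap fun _ => T t) (C := ‖p n‖) fun t ht => by
        refine (ContinuousMultilinearMap.norm_compContinuousLinearMap_le _ _).trans ?_
        refine mul_le_of_le_one_right (norm_nonneg _) ?_
        exact Finset.prod_le_one (fun _ _ => norm_nonneg _) fun _ _ => huI t ht
    simpa using this
  refine ⟨q, r, hp.r_le.trans (FormalMultilinearSeries.radius_le_of_le hq), hp.r_pos, ?_⟩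
  intro y hy
  rw [zero_add]
  have hqy (n : ℕ) : q n (fun _ => y) = ∫ t in (0 : ℝ)..1, p n fun _ => T t y := by
    have := (ContinuousMultilinearMap.apply ℝ (fun _ : Fin n => E) ℝ
      (fun _ => y)).intervalIntegral_comp_comm 
        ((hcont n).intervalIntegrable (μ := MeasureTheory.volume) 0 1)
    exact this.symm
  simp only [hqy]
  have hyr : (‖y‖₊ : ENNReal) < p.radius := by
    refine lt_of_lt_of_le ?_ hp.r_le
    rwa [Metric.mem_eball, edist_zero_right] at hy
  have hsum : Summable fun n => ‖p n‖ * ‖y‖ ^ n := p.summable_norm_mul_pow hyr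
  have hTy : ∀ t ∈ Set.uIoc (0 : ℝ) 1, ‖T t y‖ ≤ ‖y‖ := fun t ht =>
    ((T t).le_opNorm y).trans (mul_le_of_le_one_left (norm_nonneg _) (huI t ht))
  refine intervalIntegral.hasSum_integral_of_dominated_convergence
    (fun n _ => ‖p n‖ * ‖y‖ ^ n) (fun n => ?_) (fun n => ?_) ?_ ?_ ?_
  · have : Continuous fun t => p n fun _ => T t y :=
      (p n).cont.comp (continuous_pi fun _ => hT.clm_apply continuous_const)
    exact this.aestronglyMeasurable
  · refine Filter.Eventually.of_forall fun t ht => ((p n).le_opNorm _).trans ?_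
    simp only [Finset.prod_const, Finset.card_univ, Fintype.card_fin]
    gcongr
    exact hTy t ht
  · exact Filter.Eventually.of_forall fun _ _ => hsum
  · exact intervalIntegrable_const
  · refine Filter.Eventually.of_forall fun t ht => ?_
    have hmem : T t y ∈ Metric.eball (0 : E) r := by
      rw [Metric.mem_eball, edist_zero_right] at hy ⊢
      refine lt_of_le_of_lt ?_ hy
      rw [enorm_le_iff_norm_le]
      exact hTy t ht
    simpa using hp.hasSum hmem

/-- Division of an analytic function vanishing on the line `x = 0` by `x`. -/
theorem AnalyticAt.exists_eventuallyEq_fst_mul {f : ℝ × ℝ → ℝ} (hf : AnalyticAt ℝ f 0)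
    (h0 : ∀ᶠ y in 𝓝 (0 : ℝ), f (0, y) = 0) :
    ∃ g : ℝ × ℝ → ℝ, AnalyticAt ℝ g 0 ∧ f =ᶠ[𝓝 0] Prod.fst * g := by
  let T : ℝ → ℝ × ℝ →L[ℝ] ℝ × ℝ := fun t =>
    (t • ContinuousLinearMap.fst ℝ ℝ ℝ).prod (ContinuousLinearMap.snd ℝ ℝ ℝ)
  have hT : Continuous T := by
    have h1 : Continuous fun t : ℝ => t • ContinuousLinearMap.fst ℝ ℝ ℝ := by fun_prop
    exact (ContinuousLinearMap.prodₗᵢ ℝ (𝕜 := ℝ) (E := ℝ × ℝ)).continuous.comp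
      (h1.prodMk continuous_const)
  have hT1 : ∀ t ∈ Icc (0 : ℝ) 1, ‖T t‖ ≤ 1 := fun t ht => by
    refine ContinuousLinearMap.opNorm_le_bound _ zero_le_one fun z => ?_
    rw [one_mul]
    refine max_le_max ?_ le_rfl
    change ‖t * z.1‖ ≤ ‖z.1‖
    rw [norm_mul, Real.norm_of_nonneg ht.1]
    exact mul_le_of_le_one_left (norm_nonneg _) ht.2
  refine ⟨_, (hf.dirDeriv (1, 0)).intervalIntegral_comp_clm hT hT1, ?_⟩
  obtain ⟨δ, hδ, hball⟩ := Metric.eventually_nhds_iff_ball.1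
    (hf.eventually_analyticAt.and (hf.dirDeriv (1, 0)).eventually_analyticAt)
  have h0' : ∀ᶠ p : ℝ × ℝ in 𝓝 0, f (0, p.2) = 0 :=
    (continuous_snd.tendsto (0 : ℝ × ℝ)).eventually h0
  filter_upwards [h0', Metric.ball_mem_nhds (0 : ℝ × ℝ) hδ] with p hp hpδ
  have hmem : ∀ t ∈ Set.uIcc (0 : ℝ) 1, ((t * p.1, p.2) : ℝ × ℝ) ∈ Metric.ball (0 : ℝ × ℝ) δ := by
    intro t ht
    rw [Set.uIcc_of_le zero_le_one] at ht
    rw [mem_ball_zero_iff] at hpδ ⊢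
    exact lt_of_le_of_lt (((T t).le_opNorm p).trans
      (mul_le_of_le_one_left (norm_nonneg _) (hT1 t ht))) hpδ
  have hderiv : ∀ t ∈ Set.uIcc (0 : ℝ) 1, HasDerivAt (fun t => f (t * p.1, p.2))
      (p.1 * _root_.dirDeriv (1, 0) f (t * p.1, p.2)) t := fun t ht => by
    have h1 : HasDerivAt (fun t : ℝ => ((t * p.1, p.2) : ℝ × ℝ)) (p.1, 0) t := by
      simpa using ((hasDerivAt_id t).mul_const p.1).prodMk (hasDerivAt_const t p.2)
    have h2 := (hball _ (hmem t ht)).1.differentiableAt.hasFDerivAt.comp_hasDerivAt t h1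
    have : ((p.1, 0) : ℝ × ℝ) = p.1 • (1, 0) := by simp
    rw [this, map_smul] at h2
    exact h2
  have hcont : ContinuousOn (fun t : ℝ => p.1 * _root_.dirDeriv (1, 0) f (t * p.1, p.2))
      (Set.uIcc 0 1) := by
    refine continuousOn_const.mul fun t ht => ?_
    refine ContinuousAt.continuousWithinAt ?_
    exact ContinuousAt.comp (f := fun t : ℝ => ((t * p.1, p.2) : ℝ × ℝ))
      (hball _ (hmem t ht)).2.continuousAt (by fun_prop)
  have key := intervalIntegral.integral_eq_sub_of_hasDerivAt hderiv hcont.intervalIntegrable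
  rw [intervalIntegral.integral_const_mul] at key
  simp only [one_mul, zero_mul, hp, sub_zero] at key
  exact key.symm

theorem AnalyticAt.eventually_eq_zero_of_jet {f : ℝ × ℝ → ℝ} (hf : AnalyticAt ℝ f 0)
    (h0 : ∀ j, jet f 0 j = 0) : ∀ᶠ y in 𝓝 (0 : ℝ), f (0, y) = 0 := by
  have hg : AnalyticAt ℝ (fun y : ℝ => f (0, y)) 0 :=
    AnalyticAt.fun_comp (g := f) (f := fun y : ℝ => ((0 : ℝ), y)) hf
      (analyticAt_const.prod analyticAt_id)
  rw [← analyticOrderAt_eq_top, ENat.eq_top_iff_forall_ge]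
  intro n
  rw [natCast_le_analyticOrderAt_iff_iteratedDeriv_eq_zero hg]
  intro i _
  rw [← jet_zero_eq_iteratedDeriv hf, h0]

theorem AnalyticAt.exists_eventuallyEq_fst_pow_mul {f : ℝ × ℝ → ℝ} (hf : AnalyticAt ℝ f 0) {n : ℕ}
    (h0 : ∀ i < n, ∀ j, jet f i j = 0) :
    ∃ g : ℝ × ℝ → ℝ, AnalyticAt ℝ g 0 ∧ f =ᶠ[𝓝 0] Prod.fst ^ n * g := by
  induction n generalizing f with
  | zero => exact ⟨f, hf, by simp⟩
  | succ n ih =>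
    obtain ⟨g, hg, hfg⟩ := hf.exists_eventuallyEq_fst_mul
      (hf.eventually_eq_zero_of_jet (h0 0 n.succ_pos))
    have htaylor : taylor f = PowerSeries.X * taylor g := by
      rw [taylor_congr hfg, taylor_mul analyticAt_fst hg, ← pow_one (Prod.fst : ℝ × ℝ → ℝ),
        taylor_fst_pow, pow_one]
    obtain ⟨k, hk, hgk⟩ := ih hg fun i hi j => by
      rw [← coeff_coeff_taylor_eq_zero, ← PowerSeries.coeff_succ_X_mul i (taylor g), ← htaylor,
        coeff_coeff_taylor_eq_zero]
      exact h0 _ (by lia) _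
    refine ⟨k, hk, hfg.trans ?_⟩
    rw [pow_succ', mul_assoc]
    exact Filter.EventuallyEq.rfl.mul hgk

theorem VanishesTo.apply_zero_eq_of_eventuallyEq_fst_pow_mul {f g : ℝ × ℝ → ℝ} {κ : ℝ} {n : ℕ}
    (hg : AnalyticAt ℝ g 0) (hf : VanishesTo (n + 1) (f + (-κ) • Prod.fst ^ n))
    (hfg : f =ᶠ[𝓝 0] Prod.fst ^ n * g) : g 0 = κ := by
  have hc : AnalyticAt ℝ (g + fun _ => -κ) 0 := hg.add analyticAt_const
  have heq : f + (-κ) • Prod.fst ^ n =ᶠ[𝓝 0] Prod.fst ^ n * (g + fun _ => -κ) := by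
    filter_upwards [hfg] with p hp
    simp only [Pi.add_apply, Pi.smul_apply, Pi.mul_apply, smul_eq_mul, hp]
    ring
  have h := hf n 0 (by lia)
  rw [← coeff_coeff_taylor_eq_zero, taylor_congr heq, taylor_mul (analyticAt_fst.pow n) hc,
    taylor_fst_pow] at h
  have h' := PowerSeries.coeff_X_pow_mul (taylor (g + fun _ => -κ)) n 0
  rw [zero_add] at h'
  rw [h', coeff_coeff_taylor_eq_zero, jet_zero_zero] at h
  exact eq_of_sub_eq_zero (by simpa [sub_eq_add_neg] using h)

/-! ### The curve along which the traceless Hessian vanishes -/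

/-- The analytic implicit function theorem for a curve tangent to the line `x = 0`. -/
theorem AnalyticAt.exists_implicit_curve {K : ℝ × ℝ → ℝ} (hK : AnalyticAt ℝ K 0) (h0 : K 0 = 0)
    (h1 : _root_.dirDeriv (1, 0) K 0 ≠ 0) (h2 : _root_.dirDeriv (0, 1) K 0 = 0) :
    ∃ γ : ℝ → ℝ, AnalyticAt ℝ γ 0 ∧ γ 0 = 0 ∧ deriv γ 0 = 0 ∧ ∀ᶠ y in 𝓝 0, K (γ y, y) = 0 := by
  set c := _root_.dirDeriv (1, 0) K 0 with hc
  let Θ : ℝ × ℝ → ℝ × ℝ := fun p => (K p, p.2)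
  have hΘ : AnalyticAt ℝ Θ 0 := hK.prod analyticAt_snd
  have hΘ0 : Θ 0 = 0 := by simp [Θ, h0]
  let i : (ℝ × ℝ) ≃L[ℝ] (ℝ × ℝ) :=
    (ContinuousLinearEquiv.unitsEquivAut ℝ (Units.mk0 c h1)).prodCongr (.refl ℝ ℝ)
  have hfderiv : fderiv ℝ K 0 = c • ContinuousLinearMap.fst ℝ ℝ ℝ := by
    refine ContinuousLinearMap.ext fun p => ?_
    have := congrFun (dirDeriv_mk K p.1 p.2) 0
    simp only [Pi.add_apply, Pi.smul_apply, h2, smul_zero, add_zero, ← hc] at this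
    exact this.trans (mul_comm _ _)
  have hi : HasFDerivAt Θ (i : ℝ × ℝ →L[ℝ] ℝ × ℝ) 0 := by
    have h : HasFDerivAt Θ _ 0 := hK.differentiableAt.hasFDerivAt.prodMk hasFDerivAt_snd
    have hi' : (i : ℝ × ℝ →L[ℝ] ℝ × ℝ) =
        (fderiv ℝ K 0).prod (ContinuousLinearMap.snd ℝ ℝ ℝ) := by
      rw [hfderiv]
      exact ContinuousLinearMap.ext fun p => Prod.ext (mul_comm _ _) rfl
    rwa [hi']
  have hstrict : HasStrictFDerivAt Θ (i : ℝ × ℝ →L[ℝ] ℝ × ℝ) 0 := by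
    rw [← hi.fderiv]
    exact hΘ.hasStrictFDerivAt
  set e := hstrict.toOpenPartialHomeomorph Θ with he
  have hsymm : AnalyticAt ℝ e.symm 0 := by
    have := e.analyticAt_symm' hstrict.mem_toOpenPartialHomeomorph_source hΘ hi.fderiv
    rwa [he, hstrict.toOpenPartialHomeomorph_coe, hΘ0] at this
  have hline : AnalyticAt ℝ (fun y : ℝ => ((0 : ℝ), y)) 0 := analyticAt_const.prod analyticAt_id
  have hcurve : AnalyticAt ℝ (fun y : ℝ => e.symm (0, y)) 0 :=
    AnalyticAt.fun_comp (g := e.symm) (f := fun y : ℝ => ((0 : ℝ), y)) hsymm hline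
  have hγ : AnalyticAt ℝ (fun y : ℝ => (e.symm (0, y)).1) 0 :=
    AnalyticAt.fun_comp (g := Prod.fst) (f := fun y : ℝ => e.symm (0, y)) analyticAt_fst hcurve
  have htarget : ∀ᶠ y : ℝ in 𝓝 0, ((0 : ℝ), y) ∈ e.target := by
    refine hline.continuousAt.eventually_mem (e.open_target.mem_nhds ?_)
    have := hstrict.image_mem_toOpenPartialHomeomorph_target
    rwa [hΘ0] at this
  have hright : ∀ᶠ y in 𝓝 (0 : ℝ), K ((e.symm (0, y)).1, y) = 0 := by
    filter_upwards [htarget] with y hy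
    have h : Θ (e.symm (0, y)) = (0, y) := e.right_inv hy
    have h2 : (e.symm (0, y)).2 = y := congrArg Prod.snd h
    have h3 : e.symm (0, y) = ((e.symm (0, y)).1, y) := Prod.ext rfl h2
    rw [← h3]
    exact congrArg Prod.fst h
  have hγ0 : (e.symm (0, 0)).1 = 0 := by
    have h : e.symm (Θ 0) = 0 := e.left_inv hstrict.mem_toOpenPartialHomeomorph_source
    rw [hΘ0] at h
    exact congrArg Prod.fst h
  refine ⟨_, hγ, hγ0, ?_, hright⟩
  set γ : ℝ → ℝ := fun y => (e.symm (0, y)).1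
  have hpair : HasDerivAt (fun y => (γ y, y)) (deriv γ 0, 1) 0 :=
    hγ.differentiableAt.hasDerivAt.prodMk (hasDerivAt_id 0)
  have hK' : HasFDerivAt K (c • ContinuousLinearMap.fst ℝ ℝ ℝ) (γ 0, 0) := by
    rw [show ((γ 0, 0) : ℝ × ℝ) = 0 from Prod.ext hγ0 rfl, ← hfderiv]
    exact hK.differentiableAt.hasFDerivAt
  have h := HasFDerivAt.comp_hasDerivAt (f := fun y => (γ y, y)) (0 : ℝ) hK' hpair
  have h' := h.unique ((hasDerivAt_const (0 : ℝ) (0 : ℝ)).congr_of_eventuallyEq hright)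
  simpa [h1] using h'

theorem VanishesTo.coeff_coeff_taylor {h : ℝ × ℝ → ℝ} {κ : ℝ} {n : ℕ} (hh : AnalyticAt ℝ h 0)
    (hho : VanishesTo (n + 1) (h + (-κ) • Prod.fst ^ n)) {i j : ℕ} (hij : i + j < n + 1) :
    PowerSeries.coeff j (PowerSeries.coeff i (taylor h)) =
      if i = n ∧ j = 0 then (κ : ℂ) else 0 := by
  have h1 := hho i j hij
  rw [← coeff_coeff_taylor_eq_zero, taylor_add hh ((analyticAt_fst.pow n).const_smul),
    taylor_const_smul (analyticAt_fst.pow n), taylor_fst_pow, map_add, map_add] at h1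
  change _ + ((-κ : ℝ) : ℂ) •
    PowerSeries.coeff j (PowerSeries.coeff i (PowerSeries.X ^ n : PowerSeries (PowerSeries ℂ))) = 0
    at h1
  rw [PowerSeries.coeff_X_pow] at h1
  rw [eq_neg_of_add_eq_zero_left h1]
  by_cases hi : i = n <;> by_cases hj : j = 0 <;> simp [hi, hj, PowerSeries.coeff_one]

/-- The entries `b`, `c` of the traceless part of a Hessian with half-trace `h`, all of order `m + 1`
with leading terms `κ x ^ (m + 1)`, `0`, `κ x ^ (m + 1)`, are divisible by the `(m + 1)`-st power of
a regular function. -/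
theorem exists_eq_pow_mul {b c h : ℝ × ℝ → ℝ} {m : ℕ} {κ : ℝ}
    (hb : AnalyticAt ℝ b 0) (hc : AnalyticAt ℝ c 0) (hh : AnalyticAt ℝ h 0)
    (hx : dirDeriv (1, 0) h =ᶠ[𝓝 0] dirDeriv (1, 0) b + dirDeriv (0, 1) c)
    (hy : dirDeriv (1, 0) c =ᶠ[𝓝 0] dirDeriv (0, 1) h + dirDeriv (0, 1) b)
    (hJ : dirDeriv (1, 0) h * dirDeriv (0, 1) (b * b + c * c) =ᶠ[𝓝 0]
      dirDeriv (0, 1) h * dirDeriv (1, 0) (b * b + c * c))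
    (hκ : κ ≠ 0) (hbo : VanishesTo (m + 2) (b + (-κ) • Prod.fst ^ (m + 1)))
    (hco : VanishesTo (m + 2) c) (hho : VanishesTo (m + 2) (h + (-κ) • Prod.fst ^ (m + 1))) :
    ∃ s β χ : ℝ × ℝ → ℝ, AnalyticAt ℝ s 0 ∧ AnalyticAt ℝ β 0 ∧ AnalyticAt ℝ χ 0 ∧
      s 0 = 0 ∧ fderiv ℝ s 0 ≠ 0 ∧ β 0 ≠ 0 ∧
      b =ᶠ[𝓝 0] s ^ (m + 1) * β ∧ c =ᶠ[𝓝 0] s ^ (m + 1) * χ := by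
  obtain ⟨γ, hγ, h0, h0', hγh⟩ := (hh.iterate_dirDeriv (1, 0) m).exists_implicit_curve
    (coeff_coeff_taylor_eq_zero.1
      ((hho.coeff_coeff_taylor hh (i := m) (j := 0) (by lia)).trans (by simp)))
    (by
      rw [← Function.iterate_succ_apply' (f := dirDeriv (1, 0))]
      exact (coeff_coeff_taylor_eq_zero (i := m + 1) (j := 0)).not.1
        (by simp [hho.coeff_coeff_taylor hh (i := m + 1) (j := 0) (by lia), hκ]))
    (coeff_coeff_taylor_eq_zero (i := m) (j := 1).1
      ((hho.coeff_coeff_taylor hh (i := m) (j := 1) (by lia)).trans (by simp)))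
  have hjet := fun i (hi : i < m + 1) j =>
    jet_comp_shear_eq_zero hb hc hh hx hy hJ hκ hbo hco hho hγ h0 h0' hγh hi j
  obtain ⟨β, hβ, hbβ⟩ := (hb.comp_shear hγ h0).exists_eventuallyEq_fst_pow_mul
    fun i hi j => (hjet i hi j).1
  obtain ⟨χ, hχ, hcχ⟩ := (hc.comp_shear hγ h0).exists_eventuallyEq_fst_pow_mul
    fun i hi j => (hjet i hi j).2
  have hβ0 : β 0 = κ := (hbo.add_smul_fst_pow_comp_shear hb hγ h0 h0')
    |>.apply_zero_eq_of_eventuallyEq_fst_pow_mul hβ hbβ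
  have hneg : AnalyticAt ℝ (-γ) 0 := hγ.neg
  have hneg0 : (-γ) 0 = 0 := by simp [h0]
  have hpull : ∀ {f g : ℝ × ℝ → ℝ}, f ∘ shear γ =ᶠ[𝓝 0] Prod.fst ^ (m + 1) * g →
      f =ᶠ[𝓝 0] (Prod.fst ∘ shear (-γ)) ^ (m + 1) * (g ∘ shear (-γ)) := by
    intro f g hfg
    filter_upwards [(tendsto_shear hneg hneg0).eventually hfg] with p hp
    simpa [shear] using hp
  have hs : AnalyticAt ℝ (Prod.fst ∘ shear (-γ)) 0 := analyticAt_fst.comp_shear hneg hneg0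
  refine ⟨_, _, _, hs, hβ.comp_shear hneg hneg0,
    hχ.comp_shear hneg hneg0, by simp [shear, h0], ?_, ?_, hpull hbβ, hpull hcχ⟩
  · intro hzero
    have h1 := (dirDeriv_comp_shear (analyticAt_fst (𝕜 := ℝ) (p := (0 : ℝ × ℝ)))
      hneg hneg0 1 0).eq_of_nhds
    rw [dirDeriv, hzero] at h1
    simp [dirDeriv_fst] at h1
  · rwa [Function.comp, shear_zero hneg0, hβ0]

/-! ### Hessians with an aligned leading term -/

section Hessian

local notation "∂₁" => dirDeriv ((1 : ℝ), (0 : ℝ))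

local notation "∂₂" => dirDeriv ((0 : ℝ), (1 : ℝ))

variable {u : ℝ × ℝ → ℝ} {v : ℝ × ℝ}

theorem dirDeriv_const (r : ℝ) : dirDeriv v (fun _ => r) = 0 := by
  ext p
  simp [dirDeriv]

theorem dirDeriv_fst_quadratic_add_pow (c₀ a b l a₁ : ℝ) (n : ℕ) :
    ∂₁ (fun p : ℝ × ℝ => c₀ + a * p.1 + b * p.2 + l / 2 * (p.1 ^ 2 + p.2 ^ 2) +
      a₁ * p.1 ^ (n + 1)) = fun p => a + l * p.1 + a₁ * (n + 1) * p.1 ^ n := by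
  ext p
  rw [← pdx_eq_dirDeriv (by fun_prop)]
  have h := (((hasDerivAt_id p.1).const_mul a).const_add c₀).add_const (b * p.2)
    |>.add ((((hasDerivAt_id p.1).pow 2).add_const (p.2 ^ 2)).const_mul (l / 2))
    |>.add (((hasDerivAt_id p.1).pow (n + 1)).const_mul a₁)
  refine h.deriv.trans ?_
  simp only [id]
  push_cast
  ring

theorem dirDeriv_snd_quadratic_add_pow (c₀ a b l a₁ : ℝ) (n : ℕ) :
    ∂₂ (fun p : ℝ × ℝ => c₀ + a * p.1 + b * p.2 + l / 2 * (p.1 ^ 2 + p.2 ^ 2) +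
      a₁ * p.1 ^ (n + 1)) = fun p => b + l * p.2 := by
  ext p
  rw [← pdy_eq_dirDeriv (by fun_prop)]
  have h := ((hasDerivAt_id p.2).const_mul b).const_add (c₀ + a * p.1)
    |>.add ((((hasDerivAt_id p.2).pow 2).const_add (p.1 ^ 2)).const_mul (l / 2))
    |>.add_const (a₁ * p.1 ^ (n + 1))
  refine h.deriv.trans ?_
  simp only [id]
  push_cast
  ring

theorem dirDeriv_dirDeriv_of_eq_add {R q : ℝ × ℝ → ℝ} (hu : u = R + q) (hR : AnalyticAt ℝ R 0)
    (hq : AnalyticAt ℝ q 0) (v w : ℝ × ℝ) :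
    dirDeriv v (dirDeriv w u) =ᶠ[𝓝 0] dirDeriv v (dirDeriv w R) + dirDeriv v (dirDeriv w q) := by
  rw [hu]
  exact ((hR.dirDeriv_add_eventuallyEq hq).dirDeriv v).trans
    ((hR.dirDeriv w).dirDeriv_add_eventuallyEq (hq.dirDeriv w))

/-- The extension theorem when the leading term of `u` is a power of the first coordinate. -/
theorem exists_eq_pow_mul_of_aligned (hu : AnalyticAt ℝ u 0)
    (hJ : ∂₁ (∂₁ (∂₁ u) + ∂₂ (∂₂ u)) *
        ∂₂ (∂₁ (∂₁ u) * ∂₂ (∂₂ u) +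
          (-1 : ℝ) • (∂₁ (∂₂ u) * ∂₁ (∂₂ u)))
      =ᶠ[𝓝 0]
      ∂₂ (∂₁ (∂₁ u) + ∂₂ (∂₂ u)) *
        ∂₁ (∂₁ (∂₁ u) * ∂₂ (∂₂ u) +
          (-1 : ℝ) • (∂₁ (∂₂ u) * ∂₁ (∂₂ u))))
    {m : ℕ} {c₀ a b l a₁ : ℝ} (ha₁ : a₁ ≠ 0)
    (ho : (fun p : ℝ × ℝ => u p - (c₀ + a * p.1 + b * p.2 + l / 2 * (p.1 ^ 2 + p.2 ^ 2)
        + a₁ * p.1 ^ (m + 3))) =o[𝓝 0] fun p => ‖p‖ ^ (m + 3)) :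
    ∃ s β χ : ℝ × ℝ → ℝ, AnalyticAt ℝ s 0 ∧ AnalyticAt ℝ β 0 ∧ AnalyticAt ℝ χ 0 ∧
      s 0 = 0 ∧ fderiv ℝ s 0 ≠ 0 ∧ β 0 ≠ 0 ∧
      (1 / 2 : ℝ) • (∂₁ (∂₁ u) +
        (-1 : ℝ) • ∂₂ (∂₂ u)) =ᶠ[𝓝 0] s ^ (m + 1) * β ∧
      ∂₁ (∂₂ u) =ᶠ[𝓝 0] s ^ (m + 1) * χ := by
  set q : ℝ × ℝ → ℝ := fun p => c₀ + a * p.1 + b * p.2 + l / 2 * (p.1 ^ 2 + p.2 ^ 2)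
    + a₁ * p.1 ^ (m + 3) with hq
  have hqa : AnalyticAt ℝ q 0 := by
    have h1 : AnalyticAt ℝ (fun p : ℝ × ℝ => p.1) 0 := analyticAt_fst
    have h2 : AnalyticAt ℝ (fun p : ℝ × ℝ => p.2) 0 := analyticAt_snd
    fun_prop
  set R : ℝ × ℝ → ℝ := u - q with hRdef
  have hR : AnalyticAt ℝ R 0 := hu.sub hqa
  have huRq : u = R + q := by simp [hRdef]
  have hRo : VanishesTo (m + 4) R := fun i j hij =>
    jet_eq_zero_of_isLittleO hR ho (by lia)
  have hRxx := hRo.dirDeriv_fst.dirDeriv_fst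
  have hRyy := (hRo.dirDeriv_snd hR).dirDeriv_snd (hR.dirDeriv _)
  have hRxy := (hRo.dirDeriv_snd hR).dirDeriv_fst
  have hq1 : ∂₁ q = fun p => a + l * p.1 + a₁ * (m + 3) * p.1 ^ (m + 2) := by
    rw [hq, dirDeriv_fst_quadratic_add_pow]
    ext p
    push_cast
    ring
  have hq2 : ∂₂ q = fun p => b + l * p.2 := dirDeriv_snd_quadratic_add_pow ..
  have hqxx : ∂₁ (∂₁ q) =
      fun p => l + a₁ * (m + 3) * (m + 2) * p.1 ^ (m + 1) := by
    have h := dirDeriv_fst_quadratic_add_pow a l 0 0 (a₁ * (m + 3)) (m + 1)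
    simp only [zero_mul, zero_div, add_zero] at h
    rw [hq1, h]
    ext p
    push_cast
    ring
  have hqxy : ∂₁ (∂₂ q) = 0 := by
    have h := dirDeriv_fst_quadratic_add_pow b 0 l 0 0 0
    simp only [zero_mul, zero_div, add_zero] at h
    rw [hq2, h]
    rfl
  have hqyy : ∂₂ (∂₂ q) = fun _ => l := by
    have h := dirDeriv_snd_quadratic_add_pow b 0 l 0 0 0
    simp only [zero_mul, zero_div, add_zero] at h
    rw [hq2, h]
  have hxx := dirDeriv_dirDeriv_of_eq_add huRq hR hqa (1, 0) (1, 0)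
  have hyy := dirDeriv_dirDeriv_of_eq_add huRq hR hqa (0, 1) (0, 1)
  have hxy := dirDeriv_dirDeriv_of_eq_add huRq hR hqa (1, 0) (0, 1)
  rw [hqxx] at hxx
  rw [hqyy] at hyy
  rw [hqxy, add_zero] at hxy
  have haxx := (hR.dirDeriv (1, 0)).dirDeriv (1, 0)
  have hayy := (hR.dirDeriv (0, 1)).dirDeriv (0, 1)
  have huxx := (hu.dirDeriv (1, 0)).dirDeriv (1, 0)
  have huyy := (hu.dirDeriv (0, 1)).dirDeriv (0, 1)
  have huxy := (hu.dirDeriv (0, 1)).dirDeriv (1, 0)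
  have hb := (huxx.add (huyy.const_smul (c := (-1 : ℝ)))).const_smul (c := (1 / 2 : ℝ))
  have hh := ((huxx.add huyy).const_smul (c := (1 / 2 : ℝ))).add
    (analyticAt_const (v := -l))
  have third : ∀ᶠ p in 𝓝 (0 : ℝ × ℝ),
      ∂₁ (∂₂ (∂₂ u)) p =
        ∂₂ (∂₁ (∂₂ u)) p ∧
      ∂₁ (∂₁ (∂₂ u)) p =
        ∂₂ (∂₁ (∂₁ u)) p := by
    filter_upwards [(hu.dirDeriv (0, 1)).dirDeriv_comm_eventuallyEq (1, 0) (0, 1),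
      (hu.dirDeriv_comm_eventuallyEq (1, 0) (0, 1)).dirDeriv (1, 0),
      (hu.dirDeriv (1, 0)).dirDeriv_comm_eventuallyEq (1, 0) (0, 1)] with p h1 h2 h3
    exact ⟨h1, h2.trans h3⟩
  have hderivb (v : ℝ × ℝ) : ∀ᶠ p in 𝓝 0, dirDeriv v ((1 / 2 : ℝ) •
      (∂₁ (∂₁ u) + (-1 : ℝ) • ∂₂ (∂₂ u))) p =
      1 / 2 * (dirDeriv v (∂₁ (∂₁ u)) p -
        dirDeriv v (∂₂ (∂₂ u)) p) := by
    filter_upwards [huxx.eventually_analyticAt, huyy.eventually_analyticAt] with p h1 h2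
    have h1 := h1.differentiableAt
    have h2 := h2.differentiableAt
    rw [dirDeriv_const_smul (h1.add (h2.const_smul _)), dirDeriv_add h1 (h2.const_smul _),
      dirDeriv_const_smul h2]
    ring
  have hderivh (v : ℝ × ℝ) : ∀ᶠ p in 𝓝 0, dirDeriv v ((1 / 2 : ℝ) •
      (∂₁ (∂₁ u) + ∂₂ (∂₂ u)) +
        fun _ => -l) p =
      1 / 2 * (dirDeriv v (∂₁ (∂₁ u)) p +
        dirDeriv v (∂₂ (∂₂ u)) p) := by
    filter_upwards [huxx.eventually_analyticAt, huyy.eventually_analyticAt] with p h1 h2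
    have h1 := h1.differentiableAt
    have h2 := h2.differentiableAt
    rw [dirDeriv_add ((h1.add h2).const_smul _) (differentiableAt_const _),
      dirDeriv_const_smul (h1.add h2), dirDeriv_add h1 h2, dirDeriv_const]
    simp
  set κ := a₁ * (m + 3) * (m + 2) / 2 with hκ
  refine exists_eq_pow_mul (κ := κ) hb huxy hh ?_ ?_ ?_ (by positivity) ?_ (hRxy.congr hxy.symm) ?_
  · filter_upwards [hderivb (1, 0), hderivh (1, 0), third] with p h1 h2 h3
    rw [Pi.add_apply, h1, h2, ← h3.1]
    ring
  · filter_upwards [hderivb (0, 1), hderivh (0, 1), third] with p h1 h2 h3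
    rw [Pi.add_apply, h1, h2, h3.2]
    ring
  · filter_upwards [hderivb (1, 0), hderivh (1, 0), hderivb (0, 1), hderivh (0, 1), hJ,
      huxx.eventually_analyticAt, huyy.eventually_analyticAt, huxy.eventually_analyticAt,
      hb.eventually_analyticAt] with p hb1 hh1 hb2 hh2 hJ h1 h2 h3 h4
    have h1 := h1.differentiableAt
    have h2 := h2.differentiableAt
    have h3 := h3.differentiableAt
    have h4 := h4.differentiableAt
    simp only [Pi.mul_apply] at hJ ⊢
    rw [hh1, hh2, dirDeriv_add (h4.mul h4) (h3.mul h3), dirDeriv_add (h4.mul h4) (h3.mul h3),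
      dirDeriv_mul h4 h4, dirDeriv_mul h4 h4, dirDeriv_mul h3 h3, dirDeriv_mul h3 h3, hb1, hb2]
    rw [dirDeriv_add h1 h2, dirDeriv_add h1 h2,
      dirDeriv_add (h1.mul h2) ((h3.mul h3).const_smul _), dirDeriv_mul h1 h2,
      dirDeriv_add (h1.mul h2) ((h3.mul h3).const_smul _), dirDeriv_mul h1 h2,
      dirDeriv_const_smul (h3.mul h3), dirDeriv_mul h3 h3,
      dirDeriv_const_smul (h3.mul h3), dirDeriv_mul h3 h3] at hJ
    simp only [Pi.add_apply, Pi.smul_apply, smul_eq_mul]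
    linear_combination (-1 / 2) * hJ
  · refine ((hRxx.add (hRyy.const_smul hayy (-1)) haxx hayy.const_smul).const_smul
      (haxx.add hayy.const_smul) (1 / 2)).congr ?_
    filter_upwards [hxx, hyy] with p h1 h2
    simp only [Pi.add_apply, Pi.smul_apply, Pi.pow_apply, smul_eq_mul, h1, h2, hκ]
    ring
  · refine ((hRxx.add hRyy haxx hayy).const_smul (haxx.add hayy) (1 / 2)).congr ?_
    filter_upwards [hxx, hyy] with p h1 h2
    simp only [Pi.add_apply, Pi.smul_apply, Pi.pow_apply, smul_eq_mul, h1, h2, hκ]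
    ring

/-- The rotation of the plane taking `(1, 0)` to the unit vector `(α, β)`. -/
noncomputable def planeRotation (α β : ℝ) (h : α ^ 2 + β ^ 2 = 1) : (ℝ × ℝ) ≃L[ℝ] (ℝ × ℝ) :=
  ContinuousLinearEquiv.equivOfInverse
    ((α • ContinuousLinearMap.fst ℝ ℝ ℝ - β • ContinuousLinearMap.snd ℝ ℝ ℝ).prod
      (β • ContinuousLinearMap.fst ℝ ℝ ℝ + α • ContinuousLinearMap.snd ℝ ℝ ℝ))
    ((α • ContinuousLinearMap.fst ℝ ℝ ℝ + β • ContinuousLinearMap.snd ℝ ℝ ℝ).prod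
      (-β • ContinuousLinearMap.fst ℝ ℝ ℝ + α • ContinuousLinearMap.snd ℝ ℝ ℝ))
    (fun p => Prod.ext
      (show α * (α * p.1 - β * p.2) + β * (β * p.1 + α * p.2) = p.1 by
        linear_combination p.1 * h)
      (show -β * (α * p.1 - β * p.2) + α * (β * p.1 + α * p.2) = p.2 by
        linear_combination p.2 * h))
    (fun p => Prod.ext
      (show α * (α * p.1 + β * p.2) - β * (-β * p.1 + α * p.2) = p.1 by
        linear_combination p.1 * h)
      (show β * (α * p.1 + β * p.2) + α * (-β * p.1 + α * p.2) = p.2 by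
        linear_combination p.2 * h))

theorem planeRotation_apply {α β : ℝ} (h : α ^ 2 + β ^ 2 = 1) (p : ℝ × ℝ) :
    planeRotation α β h p = (α * p.1 - β * p.2, β * p.1 + α * p.2) := rfl

theorem dirDeriv_comp_equiv (L : (ℝ × ℝ) ≃L[ℝ] (ℝ × ℝ)) (f : ℝ × ℝ → ℝ) (v : ℝ × ℝ) :
    dirDeriv v (f ∘ L) = dirDeriv (L v) f ∘ L := by
  ext p
  simp [dirDeriv, L.comp_right_fderiv]

theorem AnalyticAt.dirDeriv_mk_dirDeriv_mk (hu : AnalyticAt ℝ u 0) (a b a' b' : ℝ) :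
    _root_.dirDeriv (a, b) (_root_.dirDeriv (a', b') u) =ᶠ[𝓝 0]
      (a * a') • ∂₁ (∂₁ u) + (a * b' + b * a') • ∂₁ (∂₂ u) + (b * b') • ∂₂ (∂₂ u) := by
  filter_upwards [hu.eventually_analyticAt] with p hp
  have h1 := (hp.dirDeriv (1, 0)).differentiableAt
  have h2 := (hp.dirDeriv (0, 1)).differentiableAt
  rw [dirDeriv_mk u a' b', dirDeriv_mk _ a b]
  simp only [Pi.add_apply, Pi.smul_apply, smul_eq_mul,
    dirDeriv_add (h1.const_smul a') (h2.const_smul b'), dirDeriv_const_smul h1,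
    dirDeriv_const_smul h2, hp.dirDeriv_comm (0, 1) (1, 0)]
  ring

/-- The extension theorem when the leading term of `u` is a power of an arbitrary linear form. -/
theorem exists_eq_pow_mul_of_isLittleO (hu : AnalyticAt ℝ u 0)
    (hJ : ∂₁ (∂₁ (∂₁ u) + ∂₂ (∂₂ u)) *
        ∂₂ (∂₁ (∂₁ u) * ∂₂ (∂₂ u) + (-1 : ℝ) • (∂₁ (∂₂ u) * ∂₁ (∂₂ u))) =ᶠ[𝓝 0]
      ∂₂ (∂₁ (∂₁ u) + ∂₂ (∂₂ u)) *
        ∂₁ (∂₁ (∂₁ u) * ∂₂ (∂₂ u) + (-1 : ℝ) • (∂₁ (∂₂ u) * ∂₁ (∂₂ u))))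
    {m : ℕ} {c₀ a b l a₀ A B : ℝ} (ha₀ : a₀ ≠ 0) (hAB : (A, B) ≠ (0, 0))
    (ho : (fun p : ℝ × ℝ => u p - (c₀ + a * p.1 + b * p.2 + l / 2 * (p.1 ^ 2 + p.2 ^ 2)
        + a₀ * (A * p.1 + B * p.2) ^ (m + 3))) =o[𝓝 0] fun p => ‖p‖ ^ (m + 3)) :
    ∃ s β χ : ℝ × ℝ → ℝ, AnalyticAt ℝ s 0 ∧ AnalyticAt ℝ β 0 ∧ AnalyticAt ℝ χ 0 ∧
      s 0 = 0 ∧ fderiv ℝ s 0 ≠ 0 ∧ (β 0, χ 0) ≠ (0, 0) ∧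
      (1 / 2 : ℝ) • (∂₁ (∂₁ u) + (-1 : ℝ) • ∂₂ (∂₂ u)) =ᶠ[𝓝 0] s ^ (m + 1) * β ∧
      ∂₁ (∂₂ u) =ᶠ[𝓝 0] s ^ (m + 1) * χ := by
  have hpos : 0 < A ^ 2 + B ^ 2 := by
    by_contra! hle
    have hA : A = 0 := by nlinarith [sq_nonneg A, sq_nonneg B]
    have hB : B = 0 := by nlinarith [sq_nonneg A, sq_nonneg B]
    exact hAB (by rw [hA, hB])
  obtain ⟨ρ, hρ, hρ2⟩ : ∃ ρ : ℝ, 0 < ρ ∧ ρ ^ 2 = A ^ 2 + B ^ 2 :=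
    ⟨√(A ^ 2 + B ^ 2), Real.sqrt_pos.2 hpos, Real.sq_sqrt hpos.le⟩
  obtain ⟨α, hα⟩ : ∃ α, A = ρ * α := ⟨A / ρ, by field_simp⟩
  obtain ⟨β, hβ⟩ : ∃ β, B = ρ * β := ⟨B / ρ, by field_simp⟩
  have hαβ : α ^ 2 + β ^ 2 = 1 := by
    refine mul_left_cancel₀ (pow_ne_zero 2 hρ.ne') ?_
    rw [mul_one]
    nth_rw 2 [hρ2]
    rw [hα, hβ]
    ring
  let L := planeRotation α β hαβ
  have hL1 : L (1, 0) = (α, β) := by simp [L, planeRotation_apply]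
  have hL2 : L (0, 1) = (-β, α) := by simp [L, planeRotation_apply]
  have htendL : Filter.Tendsto L (𝓝 0) (𝓝 0) := by simpa using L.continuous.tendsto 0
  have htendL' : Filter.Tendsto L.symm (𝓝 0) (𝓝 0) := by simpa using L.symm.continuous.tendsto 0
  have hsymm : ∀ {f : ℝ × ℝ → ℝ}, AnalyticAt ℝ f 0 → AnalyticAt ℝ (f ∘ L.symm) 0 :=
    fun {f} hf => AnalyticAt.comp (by simpa using hf) (L.symm.analyticAt 0)
  have hu' : AnalyticAt ℝ (u ∘ L) 0 := AnalyticAt.comp (by simpa using hu) (L.analyticAt 0)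
  have hxx : ∂₁ (∂₁ (u ∘ L)) =ᶠ[𝓝 0]
      ((α ^ 2) • ∂₁ (∂₁ u) + (2 * α * β) • ∂₁ (∂₂ u) + (β ^ 2) • ∂₂ (∂₂ u)) ∘ L := by
    rw [dirDeriv_comp_equiv, dirDeriv_comp_equiv, hL1]
    filter_upwards [htendL.eventually (hu.dirDeriv_mk_dirDeriv_mk α β α β)] with p hp
    rw [Function.comp, hp, Function.comp]
    simp only [Pi.add_apply, Pi.smul_apply, smul_eq_mul]
    ring
  have hyy : ∂₂ (∂₂ (u ∘ L)) =ᶠ[𝓝 0]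
      ((β ^ 2) • ∂₁ (∂₁ u) + (-2 * α * β) • ∂₁ (∂₂ u) + (α ^ 2) • ∂₂ (∂₂ u)) ∘ L := by
    rw [dirDeriv_comp_equiv, dirDeriv_comp_equiv, hL2]
    filter_upwards [htendL.eventually (hu.dirDeriv_mk_dirDeriv_mk (-β) α (-β) α)] with p hp
    rw [Function.comp, hp, Function.comp]
    simp only [Pi.add_apply, Pi.smul_apply, smul_eq_mul]
    ring
  have hxy : ∂₁ (∂₂ (u ∘ L)) =ᶠ[𝓝 0]
      ((-α * β) • ∂₁ (∂₁ u) + (α ^ 2 - β ^ 2) • ∂₁ (∂₂ u) + (α * β) • ∂₂ (∂₂ u)) ∘ L := by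
    rw [dirDeriv_comp_equiv, dirDeriv_comp_equiv, hL1, hL2]
    filter_upwards [htendL.eventually (hu.dirDeriv_mk_dirDeriv_mk α β (-β) α)] with p hp
    rw [Function.comp, hp, Function.comp]
    simp only [Pi.add_apply, Pi.smul_apply, smul_eq_mul]
    ring
  have hlap : ∂₁ (∂₁ (u ∘ L)) + ∂₂ (∂₂ (u ∘ L)) =ᶠ[𝓝 0] (∂₁ (∂₁ u) + ∂₂ (∂₂ u)) ∘ L := by
    filter_upwards [hxx, hyy] with p h1 h2
    simp only [Pi.add_apply, h1, h2, Function.comp, Pi.smul_apply, smul_eq_mul]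
    linear_combination (∂₁ (∂₁ u) (L p) + ∂₂ (∂₂ u) (L p)) * hαβ
  have hdet : ∂₁ (∂₁ (u ∘ L)) * ∂₂ (∂₂ (u ∘ L)) +
      (-1 : ℝ) • (∂₁ (∂₂ (u ∘ L)) * ∂₁ (∂₂ (u ∘ L))) =ᶠ[𝓝 0]
      (∂₁ (∂₁ u) * ∂₂ (∂₂ u) + (-1 : ℝ) • (∂₁ (∂₂ u) * ∂₁ (∂₂ u))) ∘ L := by
    filter_upwards [hxx, hyy, hxy] with p h1 h2 h3
    simp only [Pi.add_apply, Pi.mul_apply, h1, h2, h3, Function.comp, Pi.smul_apply, smul_eq_mul]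
    linear_combination (∂₁ (∂₁ u) (L p) * ∂₂ (∂₂ u) (L p) - ∂₁ (∂₂ u) (L p) ^ 2) *
      (α ^ 2 + β ^ 2 + 1) * hαβ
  have hJ' : ∂₁ (∂₁ (∂₁ (u ∘ L)) + ∂₂ (∂₂ (u ∘ L))) *
        ∂₂ (∂₁ (∂₁ (u ∘ L)) * ∂₂ (∂₂ (u ∘ L)) +
          (-1 : ℝ) • (∂₁ (∂₂ (u ∘ L)) * ∂₁ (∂₂ (u ∘ L)))) =ᶠ[𝓝 0]
      ∂₂ (∂₁ (∂₁ (u ∘ L)) + ∂₂ (∂₂ (u ∘ L))) *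
        ∂₁ (∂₁ (∂₁ (u ∘ L)) * ∂₂ (∂₂ (u ∘ L)) +
          (-1 : ℝ) • (∂₁ (∂₂ (u ∘ L)) * ∂₁ (∂₂ (u ∘ L)))) := by
    filter_upwards [hlap.dirDeriv (1, 0), hlap.dirDeriv (0, 1), hdet.dirDeriv (1, 0),
      hdet.dirDeriv (0, 1), htendL.eventually hJ] with p h1 h2 h3 h4 h5
    rw [Pi.mul_apply, Pi.mul_apply, h1, h2, h3, h4]
    simp only [dirDeriv_comp_equiv, hL1, hL2, Function.comp]
    rw [dirDeriv_mk _ α β, dirDeriv_mk _ (-β) α, dirDeriv_mk _ α β, dirDeriv_mk _ (-β) α]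
    simp only [Pi.mul_apply] at h5
    simp only [Pi.add_apply, Pi.smul_apply, smul_eq_mul]
    linear_combination (α ^ 2 + β ^ 2) * h5
  have ho' : (fun p : ℝ × ℝ => (u ∘ L) p - (c₀ + (a * α + b * β) * p.1 + (b * α - a * β) * p.2 +
      l / 2 * (p.1 ^ 2 + p.2 ^ 2) + (a₀ * ρ ^ (m + 3)) * p.1 ^ (m + 3))) =o[𝓝 0]
      fun p => ‖p‖ ^ (m + 3) := by
    have hO : (fun p : ℝ × ℝ => ‖L p‖ ^ (m + 3)) =O[𝓝 0] fun p => ‖p‖ ^ (m + 3) :=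
      ((L : ℝ × ℝ →L[ℝ] ℝ × ℝ).isBigO_id (𝓝 0)).norm_norm.pow (m + 3)
    refine ((ho.comp_tendsto htendL).trans_isBigO hO).congr_left fun p => ?_
    have h1 : A * (α * p.1 - β * p.2) + B * (β * p.1 + α * p.2) = ρ * p.1 := by
      rw [hα, hβ]
      linear_combination ρ * p.1 * hαβ
    simp only [Function.comp, L, planeRotation_apply, h1, mul_pow ρ]
    linear_combination -(l / 2) * (p.1 ^ 2 + p.2 ^ 2) * hαβ
  obtain ⟨s, β', χ', hs, hβ', hχ', hs0, hds, hβ0, hb, hc⟩ :=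
    exists_eq_pow_mul_of_aligned hu' hJ' (by positivity) ho'
  have hb' : ∀ᶠ p in 𝓝 (0 : ℝ × ℝ), (α ^ 2 - β ^ 2) * (1 / 2 * (∂₁ (∂₁ u) p - ∂₂ (∂₂ u) p)) +
      2 * α * β * ∂₁ (∂₂ u) p = s (L.symm p) ^ (m + 1) * β' (L.symm p) := by
    filter_upwards [htendL'.eventually hb, htendL'.eventually hxx, htendL'.eventually hyy]
      with p h1 h2 h3
    simp only [Pi.add_apply, Pi.smul_apply, Pi.mul_apply, Pi.pow_apply, smul_eq_mul, h2, h3,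
      Function.comp, L.apply_symm_apply] at h1
    rw [← h1]
    ring
  have hc' : ∀ᶠ p in 𝓝 (0 : ℝ × ℝ), (α ^ 2 - β ^ 2) * ∂₁ (∂₂ u) p -
      2 * α * β * (1 / 2 * (∂₁ (∂₁ u) p - ∂₂ (∂₂ u) p)) =
        s (L.symm p) ^ (m + 1) * χ' (L.symm p) := by
    filter_upwards [htendL'.eventually hc, htendL'.eventually hxy] with p h1 h2
    simp only [Pi.add_apply, Pi.smul_apply, Pi.mul_apply, Pi.pow_apply, smul_eq_mul, h2,
      Function.comp, L.apply_symm_apply] at h1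
    rw [← h1]
    ring
  have hangle : (α ^ 2 - β ^ 2) ^ 2 + (2 * α * β) ^ 2 = 1 := by
    linear_combination (α ^ 2 + β ^ 2 + 1) * hαβ
  refine ⟨s ∘ L.symm, ((α ^ 2 - β ^ 2) • β' + (-(2 * α * β)) • χ') ∘ L.symm,
    ((2 * α * β) • β' + (α ^ 2 - β ^ 2) • χ') ∘ L.symm, hsymm hs,
    hsymm (hβ'.const_smul.add hχ'.const_smul), hsymm (hβ'.const_smul.add hχ'.const_smul),
    by simp [hs0], ?_, ?_, ?_, ?_⟩
  · rw [L.symm.comp_right_fderiv, map_zero]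
    intro h
    refine hds (ContinuousLinearMap.ext fun p => ?_)
    simpa using DFunLike.congr_fun h (L p)
  · intro h
    simp only [Prod.mk.injEq, Function.comp, map_zero, Pi.add_apply, Pi.smul_apply,
      smul_eq_mul] at h
    refine hβ0 ?_
    linear_combination (α ^ 2 - β ^ 2) * h.1 + 2 * α * β * h.2 - β' 0 * hangle
  · filter_upwards [hb', hc'] with p h1 h2
    simp only [Pi.add_apply, Pi.smul_apply, Pi.mul_apply, Pi.pow_apply, smul_eq_mul, Function.comp]
    linear_combination (α ^ 2 - β ^ 2) * h1 - 2 * α * β * h2 -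
      (1 / 2 * (∂₁ (∂₁ u) p - ∂₂ (∂₂ u) p)) * hangle
  · filter_upwards [hb', hc'] with p h1 h2
    simp only [Pi.add_apply, Pi.smul_apply, Pi.mul_apply, Pi.pow_apply, smul_eq_mul, Function.comp]
    linear_combination 2 * α * β * h1 + (α ^ 2 - β ^ 2) * h2 - ∂₁ (∂₂ u) p * hangle

end Hessian

theorem AnalyticAt.pdx_pdx_eventuallyEq {u : ℝ × ℝ → ℝ} {p : ℝ × ℝ} (hu : AnalyticAt ℝ u p) :
    pdx (pdx u) =ᶠ[𝓝 p] _root_.dirDeriv (1, 0) (_root_.dirDeriv (1, 0) u) :=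
  ((hu.dirDeriv _).congr hu.pdx_eventuallyEq.symm).pdx_eventuallyEq.trans
    (hu.pdx_eventuallyEq.dirDeriv _)

theorem AnalyticAt.pdx_pdy_eventuallyEq {u : ℝ × ℝ → ℝ} {p : ℝ × ℝ} (hu : AnalyticAt ℝ u p) :
    pdx (pdy u) =ᶠ[𝓝 p] _root_.dirDeriv (1, 0) (_root_.dirDeriv (0, 1) u) :=
  ((hu.dirDeriv _).congr hu.pdy_eventuallyEq.symm).pdx_eventuallyEq.trans
    (hu.pdy_eventuallyEq.dirDeriv _)

theorem AnalyticAt.pdy_pdx_eventuallyEq {u : ℝ × ℝ → ℝ} {p : ℝ × ℝ} (hu : AnalyticAt ℝ u p) :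
    pdy (pdx u) =ᶠ[𝓝 p] _root_.dirDeriv (1, 0) (_root_.dirDeriv (0, 1) u) :=
  ((hu.dirDeriv _).congr hu.pdx_eventuallyEq.symm).pdy_eventuallyEq.trans
    ((hu.pdx_eventuallyEq.dirDeriv _).trans (hu.dirDeriv_comm_eventuallyEq _ _))

theorem AnalyticAt.pdy_pdy_eventuallyEq {u : ℝ × ℝ → ℝ} {p : ℝ × ℝ} (hu : AnalyticAt ℝ u p) :
    pdy (pdy u) =ᶠ[𝓝 p] _root_.dirDeriv (0, 1) (_root_.dirDeriv (0, 1) u) :=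
  ((hu.dirDeriv _).congr hu.pdy_eventuallyEq.symm).pdy_eventuallyEq.trans
    (hu.pdy_eventuallyEq.dirDeriv _)

/-- **Proposition 2 (case C.2).** Let `u` be real analytic near the origin with
`J[Δu, det D²u] ≡ 0`, `D²u(0,0) = λ·Id`, `u` not a polynomial of degree at most two, and
suppose the lowest-degree non-zero homogeneous term `w`, of degree `n+2 ≥ 3`, of `u` minus
its second-order Taylor polynomial is `a₀·ℓ(x,y)^(n+2)` for a non-zero linear form `ℓ`.
Then on a disk `D(ε)` one can write `D²u − (Δu/2)·Id = sⁿ B` with `s` real analytic,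
`s(0,0) = 0`, `∇s(0,0) ≠ 0`, and `B = [[b, c], [c, −b]]` real analytic traceless symmetric
with `B(0,0) ≠ 0`; moreover the set where `D²u` is a scalar multiple of the identity is
exactly `{s = 0}`. -/
theorem eigenline_extension_case_C2
    (u : ℝ × ℝ → ℝ) (V : Set (ℝ × ℝ)) (hVopen : IsOpen V) (hV0 : (0, 0) ∈ V)
    (hu : AnalyticOnNhd ℝ u V)
    (hJ : ∀ p ∈ V, jacDet (lap u) (hessDet u) p = 0)
    -- `D²u(0,0) = λ·Id`
    (l : ℝ) (hH11 : pdx (pdx u) (0, 0) = l) (hH22 : pdy (pdy u) (0, 0) = l)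
    (hH12 : pdx (pdy u) (0, 0) = 0) (hH21 : pdy (pdx u) (0, 0) = 0)
    -- `u` is not a polynomial of degree at most two
    (hnp : ¬∃ P : MvPolynomial (Fin 2) ℝ, P.totalDegree ≤ 2 ∧
      ∀ p ∈ V, u p = MvPolynomial.eval ![p.1, p.2] P)
    -- the lowest-degree non-zero homogeneous Taylor term of `u` minus its 2-jet is
    -- `a₀ (Ax + By)^(n+2)`
    (n : ℕ) (hn : 1 ≤ n) (a₀ A B : ℝ) (ha₀ : a₀ ≠ 0) (hAB : (A, B) ≠ ((0 : ℝ), (0 : ℝ)))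
    (c₀ a b : ℝ)
    (ho : (fun p : ℝ × ℝ => u p - (c₀ + a * p.1 + b * p.2 + l / 2 * (p.1 ^ 2 + p.2 ^ 2)
        + a₀ * (A * p.1 + B * p.2) ^ (n + 2)))
      =o[𝓝 ((0, 0) : ℝ × ℝ)] fun p => ‖p‖ ^ (n + 2)) :
    ∃ ε : ℝ, 0 < ε ∧ {p : ℝ × ℝ | p.1 ^ 2 + p.2 ^ 2 < ε ^ 2} ⊆ V ∧
      ∃ s bb cc : ℝ × ℝ → ℝ,
        AnalyticOnNhd ℝ s {p : ℝ × ℝ | p.1 ^ 2 + p.2 ^ 2 < ε ^ 2} ∧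
        AnalyticOnNhd ℝ bb {p : ℝ × ℝ | p.1 ^ 2 + p.2 ^ 2 < ε ^ 2} ∧
        AnalyticOnNhd ℝ cc {p : ℝ × ℝ | p.1 ^ 2 + p.2 ^ 2 < ε ^ 2} ∧
        s (0, 0) = 0 ∧
        (pdx s (0, 0), pdy s (0, 0)) ≠ ((0 : ℝ), (0 : ℝ)) ∧
        (bb (0, 0), cc (0, 0)) ≠ ((0 : ℝ), (0 : ℝ)) ∧
        (∀ p : ℝ × ℝ, p.1 ^ 2 + p.2 ^ 2 < ε ^ 2 →
          pdx (pdx u) p - lap u p / 2 = s p ^ n * bb p ∧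
          pdy (pdy u) p - lap u p / 2 = -(s p ^ n * bb p) ∧
          pdx (pdy u) p = s p ^ n * cc p ∧
          pdy (pdx u) p = s p ^ n * cc p) ∧
        (∀ p : ℝ × ℝ, p.1 ^ 2 + p.2 ^ 2 < ε ^ 2 →
          ((∃ μ : ℝ, pdx (pdx u) p = μ ∧ pdy (pdy u) p = μ ∧
            pdx (pdy u) p = 0 ∧ pdy (pdx u) p = 0) ↔ s p = 0)) := by
  obtain ⟨m, rfl⟩ := Nat.exists_eq_add_of_le' hn
  have hu0 : AnalyticAt ℝ u 0 := hu _ hV0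
  have hxx := hu0.pdx_pdx_eventuallyEq
  have hxy := hu0.pdx_pdy_eventuallyEq
  have hyx := hu0.pdy_pdx_eventuallyEq
  have hyy := hu0.pdy_pdy_eventuallyEq
  have haxx := (hu0.dirDeriv (1, 0)).dirDeriv (1, 0)
  have haxy := (hu0.dirDeriv (0, 1)).dirDeriv (1, 0)
  have hayy := (hu0.dirDeriv (0, 1)).dirDeriv (0, 1)
  have hlap : lap u =ᶠ[𝓝 0]
      dirDeriv (1, 0) (dirDeriv (1, 0) u) + dirDeriv (0, 1) (dirDeriv (0, 1) u) := by
    filter_upwards [hxx, hyy] with p h1 h2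
    rw [lap, h1, h2, Pi.add_apply]
  have hdet : hessDet u =ᶠ[𝓝 0]
      dirDeriv (1, 0) (dirDeriv (1, 0) u) * dirDeriv (0, 1) (dirDeriv (0, 1) u) +
        (-1 : ℝ) • (dirDeriv (1, 0) (dirDeriv (0, 1) u) *
          dirDeriv (1, 0) (dirDeriv (0, 1) u)) := by
    filter_upwards [hxx, hyy, hxy] with p h1 h2 h3
    rw [hessDet, h1, h2, h3]
    simp only [Pi.add_apply, Pi.mul_apply, Pi.smul_apply, smul_eq_mul]
    ring
  have halap := (haxx.add hayy).congr hlap.symm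
  have hadet := ((haxx.mul hayy).add (haxy.mul haxy).const_smul).congr hdet.symm
  have hV : ∀ᶠ p in 𝓝 (0 : ℝ × ℝ), p ∈ V := hVopen.mem_nhds hV0
  obtain ⟨s, β, χ, hs, hβ, hχ, hs0, hds, h0, hb, hc⟩ :=
    exists_eq_pow_mul_of_isLittleO hu0 (by
      filter_upwards [halap.pdx_eventuallyEq.trans (hlap.dirDeriv _),
        halap.pdy_eventuallyEq.trans (hlap.dirDeriv _),
        hadet.pdx_eventuallyEq.trans (hdet.dirDeriv _),
        hadet.pdy_eventuallyEq.trans (hdet.dirDeriv _), hV] with p h1 h2 h3 h4 hp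
      rw [Pi.mul_apply, Pi.mul_apply, ← h1, ← h2, ← h3, ← h4]
      exact sub_eq_zero.1 (hJ p hp)) ha₀ hAB ho
  have hne : ∀ᶠ p in 𝓝 (0 : ℝ × ℝ), (β p, χ p) ≠ (0, 0) :=
    (hβ.continuousAt.prodMk hχ.continuousAt).eventually_ne h0
  obtain ⟨ε, hε, hball⟩ := Metric.eventually_nhds_iff_ball.1
    (((hV.and hne).and (hs.eventually_analyticAt.and
      (hβ.eventually_analyticAt.and hχ.eventually_analyticAt))).and
      ((hxx.and hyy).and ((hxy.and hyx).and (hb.and hc))))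
  have hdisk : ∀ p : ℝ × ℝ, p.1 ^ 2 + p.2 ^ 2 < ε ^ 2 → p ∈ Metric.ball (0 : ℝ × ℝ) ε := by
    intro p hp
    rw [mem_ball_zero_iff]
    exact max_lt (abs_lt_of_sq_lt_sq (by nlinarith [sq_nonneg p.2]) hε.le)
      (abs_lt_of_sq_lt_sq (by nlinarith [sq_nonneg p.1]) hε.le)
  have hentries : ∀ p : ℝ × ℝ, p.1 ^ 2 + p.2 ^ 2 < ε ^ 2 →
      pdx (pdx u) p - lap u p / 2 = s p ^ (m + 1) * β p ∧
      pdy (pdy u) p - lap u p / 2 = -(s p ^ (m + 1) * β p) ∧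
      pdx (pdy u) p = s p ^ (m + 1) * χ p ∧
      pdy (pdx u) p = s p ^ (m + 1) * χ p := by
    intro p hp
    obtain ⟨-, ⟨h1, h2⟩, ⟨h3, h4⟩, h5, h6⟩ := hball p (hdisk p hp)
    simp only [Pi.add_apply, Pi.mul_apply, Pi.smul_apply, Pi.pow_apply, smul_eq_mul] at h5 h6
    rw [lap, h1, h2, h3, h4, h6, ← h5]
    refine ⟨by ring, by ring, rfl, rfl⟩
  refine ⟨ε, hε, fun p hp => (hball p (hdisk p hp)).1.1.1, s, β, χ,
    fun p hp => (hball p (hdisk p hp)).1.2.1, fun p hp => (hball p (hdisk p hp)).1.2.2.1,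
    fun p hp => (hball p (hdisk p hp)).1.2.2.2, hs0, ?_, h0, hentries, fun p hp => ?_⟩
  · intro h
    have hx : dirDeriv (1, 0) s 0 = 0 :=
      (pdx_eq_dirDeriv hs.differentiableAt).symm.trans (congrArg Prod.fst h)
    have hy : dirDeriv (0, 1) s 0 = 0 :=
      (pdy_eq_dirDeriv hs.differentiableAt).symm.trans (congrArg Prod.snd h)
    refine hds (ContinuousLinearMap.ext fun v => ?_)
    exact (congrFun (dirDeriv_mk s v.1 v.2) 0).trans (by simp [hx, hy])
  · obtain ⟨h1, h2, h3, h4⟩ := hentries p hp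
    constructor
    · rintro ⟨μ, hμ1, hμ2, hμ3, -⟩
      rw [lap, hμ1, hμ2] at h1
      have hβ0 : s p ^ (m + 1) * β p = 0 := by rw [← h1]; ring
      have hχ0 : s p ^ (m + 1) * χ p = 0 := by rw [← h3, hμ3]
      by_contra hsp
      refine (hball p (hdisk p hp)).1.1.2 (Prod.ext ?_ ?_)
      · exact (mul_eq_zero.1 hβ0).resolve_left (pow_ne_zero _ hsp)
      · exact (mul_eq_zero.1 hχ0).resolve_left (pow_ne_zero _ hsp)
    · intro hsp
      rw [hsp, zero_pow m.succ_ne_zero, zero_mul] at h1 h2 h3 h4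
      rw [neg_zero] at h2
      exact ⟨lap u p / 2, by linarith, by linarith, h3, h4⟩
end

section
/- In the setting of the previous result (u real analytic near the origin in ℝ² with J[Δu, det D²u] ≡ 0, D²u(0,0) = λ·Id, u not a polynomial of degree ≤ 2, and the lowest non-zero homogeneous term w of degree n+2 ≥ 3 of u minus its 2-jet equal to a non-zero multiple of the (n+2)-nd power of a linear form), let s and B be as in its conclusion, so that D²u − (Δu/2)·Id = sⁿB near the origin with ∇s(0,0) ≠ 0 and B(0,0) ≠ 0 traceless symmetric. Then the tangent direction to the curve {s = 0} at the origin is an eigendirection of B(0,0): every non-zero vector v ∈ ℝ² with ⟨v, ∇s(0,0)⟩ = 0 satisfies that B(0,0)v is a scalar multiple of v. -/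
open Set Metric Topology Asymptotics MvPolynomial Matrix

section VanishingOrder

variable {E F : Type*} [NormedAddCommGroup E] [NormedSpace ℝ E]
  [NormedAddCommGroup F] [NormedSpace ℝ F]

/-- A function that is `o(‖y‖ ^ k)` at the origin has vanishing rescaled limits of degree `k`
along every line. -/
lemma Asymptotics.IsLittleO.tendsto_inv_pow_smul_line {f : E → F} {k : ℕ}
    (h : f =o[𝓝 0] fun y => ‖y‖ ^ k) (y : E) :
    Filter.Tendsto (fun t : ℝ => (t ^ k)⁻¹ • f (t • y)) (𝓝[≠] 0) (𝓝 0) := by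
  have ht : Filter.Tendsto (fun t : ℝ => t • y) (𝓝[≠] 0) (𝓝 0) := by
    have : Filter.Tendsto (fun t : ℝ => t • y) (𝓝 0) (𝓝 ((0 : ℝ) • y)) :=
      (continuous_id.smul continuous_const).tendsto 0
    rw [zero_smul] at this
    exact this.mono_left nhdsWithin_le_nhds
  have hpow : (fun t : ℝ => ‖t • y‖ ^ k) =O[𝓝[≠] 0] fun t : ℝ => t ^ k := by
    refine IsBigO.of_bound (‖y‖ ^ k) (Filter.Eventually.of_forall fun t => ?_)
    simp [norm_smul, mul_pow, mul_comm]
  have ho := (h.comp_tendsto ht).trans_isBigO hpow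
  have := (isBigO_refl (fun t : ℝ => (t ^ k)⁻¹) (𝓝[≠] 0)).smul_isLittleO ho
  refine (isLittleO_one_iff ℝ).1 (this.trans_isBigO (IsBigO.of_bound 1 ?_))
  filter_upwards [self_mem_nhdsWithin] with t ht
  have : t ^ k ≠ 0 := pow_ne_zero _ ht
  simp [this]

/-- A homogeneous map of degree `k` that is `o(‖y‖ ^ k)` at the origin vanishes. -/
lemma ContinuousMultilinearMap.apply_diag_eq_zero_of_isLittleO {k : ℕ}
    {q : ContinuousMultilinearMap ℝ (fun _ : Fin k => E) F}
    (h : (fun y => q fun _ => y) =o[𝓝 0] fun y => ‖y‖ ^ k) (y : E) : (q fun _ => y) = 0 := by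
  refine tendsto_nhds_unique (Filter.Tendsto.congr' ?_ tendsto_const_nhds)
    (h.tendsto_inv_pow_smul_line y)
  filter_upwards [self_mem_nhdsWithin] with t ht
  have ht' : t ^ k ≠ 0 := pow_ne_zero _ ht
  have := q.map_smul_univ (fun _ => t) (fun _ => y)
  simp only [Finset.prod_const, Finset.card_univ, Fintype.card_fin] at this
  rw [this, inv_smul_smul₀ ht']

/-- The terms of degree at most `m` in the power series of a function that is `o(‖y‖ ^ m)` vanish
on the diagonal. -/
lemma HasFPowerSeriesAt.apply_diag_eq_zero_of_isLittleO {f : E → F}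
    {p : FormalMultilinearSeries ℝ E F} {m : ℕ} (hf : HasFPowerSeriesAt f p 0)
    (h : f =o[𝓝 0] fun y => ‖y‖ ^ m) {k : ℕ} (hk : k ≤ m) (y : E) : (p k fun _ => y) = 0 := by
  induction k using Nat.strong_induction_on generalizing y with
  | _ k ih =>
    apply ContinuousMultilinearMap.apply_diag_eq_zero_of_isLittleO
    have hpow : ∀ {i j : ℕ}, i ≤ j →
        (fun y : E => ‖y‖ ^ j) =O[𝓝 0] fun y => ‖y‖ ^ i := fun {i j} hij => by
      refine IsBigO.of_bound 1 ?_
      filter_upwards [Metric.ball_mem_nhds (0 : E) one_pos] with z hz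
      rw [mem_ball_zero_iff] at hz
      simpa using pow_le_pow_of_le_one (norm_nonneg z) hz.le hij
    have hlt : (fun y : E => ‖y‖ ^ (k + 1)) =o[𝓝 0] fun y => ‖y‖ ^ k :=
      (isLittleO_pow_pow (𝕜 := ℝ) k.lt_succ_self).comp_tendsto tendsto_norm_zero
    have h1 := (hf.isBigO_sub_partialSum_pow (k + 1)).trans_isLittleO hlt
    refine ((h.trans_isBigO (hpow hk)).sub h1).congr_left fun z => ?_
    have : p.partialSum (k + 1) z = p k fun _ => z := by
      rw [FormalMultilinearSeries.partialSum, Finset.sum_range_succ,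
        Finset.sum_eq_zero fun j hj => ?_, zero_add]
      have hj := Finset.mem_range.1 hj
      exact ih j hj (hj.le.trans hk) z
    simp [this]

/-- Differentiation lowers the vanishing order of an analytic function by at most one. -/
lemma AnalyticAt.fderiv_isLittleO_pow [CompleteSpace F] {f : E → F} {m : ℕ}
    (hf : AnalyticAt ℝ f 0) (h : f =o[𝓝 0] fun y => ‖y‖ ^ (m + 1)) :
    fderiv ℝ f =o[𝓝 0] fun y => ‖y‖ ^ m := by
  obtain ⟨p, r, hp⟩ := hf
  have hdiag := fun k (hk : k ≤ m + 1) y =>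
    hp.hasFPowerSeriesAt.apply_diag_eq_zero_of_isLittleO h hk y
  let q : FormalMultilinearSeries ℝ E F := fun k => if k ≤ m + 1 then 0 else p k
  have hq : HasFPowerSeriesOnBall f q 0 r := by
    refine ⟨hp.r_le.trans (FormalMultilinearSeries.radius_le_of_le fun k => ?_), hp.r_pos,
      fun {y} hy => ?_⟩
    · by_cases hk : k ≤ m + 1 <;> simp [q, hk]
    · convert hp.hasSum hy using 2 with k
      by_cases hk : k ≤ m + 1 <;> simp [q, hk, hdiag]
  have hO := hq.fderiv.hasFPowerSeriesAt.isBigO_sub_partialSum_pow (m + 1)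
  have hlt : (fun y : E => ‖y‖ ^ (m + 1)) =o[𝓝 0] fun y => ‖y‖ ^ m :=
    (isLittleO_pow_pow (𝕜 := ℝ) m.lt_succ_self).comp_tendsto tendsto_norm_zero
  refine (hO.trans_isLittleO hlt).congr_left fun y => ?_
  have : q.derivSeries.partialSum (m + 1) y = 0 := Finset.sum_eq_zero fun j hj => by
    have hj : j + 1 ≤ m + 1 := Finset.mem_range.1 hj
    rw [q.derivSeries_eq_zero (by simp only [q, if_pos hj])]
    simp
  simp [this]

end VanishingOrder

section PartialDerivatives

variable {f g : ℝ × ℝ → ℝ} {p : ℝ × ℝ}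

lemma pdx_eq_fderiv (hf : DifferentiableAt ℝ f p) : pdx f p = fderiv ℝ f p (1, 0) := by
  have h : HasDerivAt (fun x : ℝ => (x, p.2)) (1, 0) p.1 :=
    (hasDerivAt_id _).prodMk (hasDerivAt_const _ _)
  exact (HasFDerivAt.comp_hasDerivAt (f := fun x : ℝ => (x, p.2)) p.1 hf.hasFDerivAt h).deriv

lemma pdy_eq_fderiv (hf : DifferentiableAt ℝ f p) : pdy f p = fderiv ℝ f p (0, 1) := by
  have h : HasDerivAt (fun y : ℝ => (p.1, y)) (0, 1) p.2 :=
    (hasDerivAt_const _ _).prodMk (hasDerivAt_id _)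
  exact (HasFDerivAt.comp_hasDerivAt (f := fun y : ℝ => (p.1, y)) p.2 hf.hasFDerivAt h).deriv

lemma pdx_eventuallyEq_fderiv (hf : AnalyticAt ℝ f p) :
    pdx f =ᶠ[𝓝 p] fun z => fderiv ℝ f z (1, 0) :=
  hf.eventually_analyticAt.mono fun _ hz => pdx_eq_fderiv hz.differentiableAt

lemma pdy_eventuallyEq_fderiv (hf : AnalyticAt ℝ f p) :
    pdy f =ᶠ[𝓝 p] fun z => fderiv ℝ f z (0, 1) :=
  hf.eventually_analyticAt.mono fun _ hz => pdy_eq_fderiv hz.differentiableAt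

lemma AnalyticAt.pdx (hf : AnalyticAt ℝ f p) : AnalyticAt ℝ (pdx f) p :=
  (((ContinuousLinearMap.apply ℝ ℝ ((1, 0) : ℝ × ℝ)).analyticAt _).comp hf.fderiv).congr
    (pdx_eventuallyEq_fderiv hf).symm

lemma AnalyticAt.pdy (hf : AnalyticAt ℝ f p) : AnalyticAt ℝ (pdy f) p :=
  (((ContinuousLinearMap.apply ℝ ℝ ((0, 1) : ℝ × ℝ)).analyticAt _).comp hf.fderiv).congr
    (pdy_eventuallyEq_fderiv hf).symm

lemma pdx_sub (hf : DifferentiableAt ℝ f p) (hg : DifferentiableAt ℝ g p) :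
    pdx (f - g) p = pdx f p - pdx g p := by
  rw [pdx_eq_fderiv (hf.sub hg), pdx_eq_fderiv hf, pdx_eq_fderiv hg, fderiv_sub hf hg]
  rfl

lemma pdy_sub (hf : DifferentiableAt ℝ f p) (hg : DifferentiableAt ℝ g p) :
    pdy (f - g) p = pdy f p - pdy g p := by
  rw [pdy_eq_fderiv (hf.sub hg), pdy_eq_fderiv hf, pdy_eq_fderiv hg, fderiv_sub hf hg]
  rfl

/-- If `f` and `g` agree to order `m + 1` at the origin, then `f_x` and `g_x` agree to
order `m`. -/
lemma AnalyticAt.pdx_sub_isLittleO {m : ℕ} (hf : AnalyticAt ℝ f 0) (hg : AnalyticAt ℝ g 0)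
    (h : (f - g) =o[𝓝 0] fun y => ‖y‖ ^ (m + 1)) :
    (_root_.pdx f - _root_.pdx g) =o[𝓝 0] fun y => ‖y‖ ^ m := by
  have hO : (fun z => fderiv ℝ (f - g) z (1, 0)) =O[𝓝 0] fderiv ℝ (f - g) :=
    IsBigO.of_bound ‖((1, 0) : ℝ × ℝ)‖ (Filter.Eventually.of_forall fun z => by
      rw [mul_comm]; exact (fderiv ℝ (f - g) z).le_opNorm _)
  refine (hO.trans_isLittleO ((hf.sub hg).fderiv_isLittleO_pow h)).congr' ?_ .rfl
  filter_upwards [hf.eventually_analyticAt, hg.eventually_analyticAt] with z hfz hgz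
  have hfz := hfz.differentiableAt
  have hgz := hgz.differentiableAt
  rw [← pdx_eq_fderiv (hfz.sub hgz), pdx_sub hfz hgz, Pi.sub_apply]

/-- If `f` and `g` agree to order `m + 1` at the origin, then `f_y` and `g_y` agree to
order `m`. -/
lemma AnalyticAt.pdy_sub_isLittleO {m : ℕ} (hf : AnalyticAt ℝ f 0) (hg : AnalyticAt ℝ g 0)
    (h : (f - g) =o[𝓝 0] fun y => ‖y‖ ^ (m + 1)) :
    (_root_.pdy f - _root_.pdy g) =o[𝓝 0] fun y => ‖y‖ ^ m := by
  have hO : (fun z => fderiv ℝ (f - g) z (0, 1)) =O[𝓝 0] fderiv ℝ (f - g) :=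
    IsBigO.of_bound ‖((0, 1) : ℝ × ℝ)‖ (Filter.Eventually.of_forall fun z => by
      rw [mul_comm]; exact (fderiv ℝ (f - g) z).le_opNorm _)
  refine (hO.trans_isLittleO ((hf.sub hg).fderiv_isLittleO_pow h)).congr' ?_ .rfl
  filter_upwards [hf.eventually_analyticAt, hg.eventually_analyticAt] with z hfz hgz
  have hfz := hfz.differentiableAt
  have hgz := hgz.differentiableAt
  rw [← pdy_eq_fderiv (hfz.sub hgz), pdy_sub hfz hgz, Pi.sub_apply]

/-- A function vanishing at the origin is asymptotic to its differential along lines. -/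
lemma tendsto_inv_mul_line {s : ℝ × ℝ → ℝ} (hs : DifferentiableAt ℝ s 0) (hs0 : s 0 = 0)
    (q : ℝ × ℝ) :
    Filter.Tendsto (fun t : ℝ => t⁻¹ * s (t • q)) (𝓝[≠] 0)
      (𝓝 (q.1 * pdx s 0 + q.2 * pdy s 0)) := by
  have hline : HasDerivAt (fun t : ℝ => t • q) q 0 := by
    simpa using (hasDerivAt_id (0 : ℝ)).smul_const q
  have hs' : HasFDerivAt s (fderiv ℝ s 0) ((0 : ℝ) • q) := by
    rw [zero_smul]; exact hs.hasFDerivAt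
  have h := (HasFDerivAt.comp_hasDerivAt (f := fun t : ℝ => t • q) 0 hs' hline).tendsto_slope_zero
  have hq : fderiv ℝ s 0 q = q.1 * pdx s 0 + q.2 * pdy s 0 := by
    rw [pdx_eq_fderiv hs, pdy_eq_fderiv hs]
    conv_lhs => rw [show q = q.1 • ((1, 0) : ℝ × ℝ) + q.2 • ((0, 1) : ℝ × ℝ) by ext <;> simp]
    rw [map_add, map_smul, map_smul, smul_eq_mul, smul_eq_mul]
  rw [← hq]
  simpa [hs0] using h

/-- The homogeneous part of degree `n` of `s ^ n * β` is `(∇s(0) · q) ^ n * β(0)`; if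
`s ^ n * β` agrees to order `n` with `K * (A x + B y) ^ n`, the two forms coincide. -/
lemma leading_form_eq {s β : ℝ × ℝ → ℝ} {n : ℕ} {K A B : ℝ} (hs : DifferentiableAt ℝ s 0)
    (hs0 : s 0 = 0) (hβ : ContinuousAt β 0)
    (h : (fun z : ℝ × ℝ => s z ^ n * β z - K * (A * z.1 + B * z.2) ^ n) =o[𝓝 0]
      fun z => ‖z‖ ^ n) (q : ℝ × ℝ) :
    (q.1 * pdx s 0 + q.2 * pdy s 0) ^ n * β 0 = K * (A * q.1 + B * q.2) ^ n := by
  have hline : Filter.Tendsto (fun t : ℝ => t • q) (𝓝[≠] 0) (𝓝 0) := by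
    have : Filter.Tendsto (fun t : ℝ => t • q) (𝓝 0) (𝓝 ((0 : ℝ) • q)) :=
      (continuous_id.smul continuous_const).tendsto 0
    rw [zero_smul] at this
    exact this.mono_left nhdsWithin_le_nhds
  have h1 := (((tendsto_inv_mul_line hs hs0 q).pow n).mul (hβ.tendsto.comp hline)).sub
    (tendsto_const_nhds (x := K * (A * q.1 + B * q.2) ^ n))
  refine sub_eq_zero.1 (tendsto_nhds_unique (h1.congr' ?_) (h.tendsto_inv_pow_smul_line q))
  filter_upwards [self_mem_nhdsWithin] with t ht
  have ht : t ≠ 0 := ht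
  have : A * (t • q).1 + B * (t • q).2 = t * (A * q.1 + B * q.2) := by
    simp only [Prod.smul_fst, Prod.smul_snd, smul_eq_mul]; ring
  rw [this, smul_eq_mul, Function.comp_apply, mul_pow, mul_pow, inv_pow]
  field_simp

end PartialDerivatives

/-- The quadratic jet plus the `m`-th power of a linear form. -/
noncomputable def jetModel (c₀ a b l a₀ A B : ℝ) (m : ℕ) (p : ℝ × ℝ) : ℝ :=
  c₀ + a * p.1 + b * p.2 + l / 2 * (p.1 ^ 2 + p.2 ^ 2) + a₀ * (A * p.1 + B * p.2) ^ m

section JetModel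

variable (c₀ a b l a₀ A B : ℝ) (n : ℕ)

lemma analyticAt_jetModel (m : ℕ) (p : ℝ × ℝ) :
    AnalyticAt ℝ (jetModel c₀ a b l a₀ A B m) p := by
  have h1 : AnalyticAt ℝ (fun q : ℝ × ℝ => q.1) p := analyticAt_fst
  have h2 : AnalyticAt ℝ (fun q : ℝ × ℝ => q.2) p := analyticAt_snd
  unfold jetModel
  fun_prop

lemma pdx_jetModel : pdx (jetModel c₀ a b l a₀ A B (n + 2)) =
    fun p => a + l * p.1 + a₀ * (n + 2) * A * (A * p.1 + B * p.2) ^ (n + 1) := by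
  funext p
  have h := (((((hasDerivAt_id p.1).const_mul a).const_add c₀).add_const (b * p.2)).add
    ((((hasDerivAt_id p.1).pow 2).add_const (p.2 ^ 2)).const_mul (l / 2))).add
    (((((hasDerivAt_id p.1).const_mul A).add_const (B * p.2)).pow (n + 2)).const_mul a₀)
  refine h.deriv.trans ?_
  simp
  ring

lemma pdy_jetModel : pdy (jetModel c₀ a b l a₀ A B (n + 2)) =
    fun p => b + l * p.2 + a₀ * (n + 2) * B * (A * p.1 + B * p.2) ^ (n + 1) := by
  funext p
  have h := ((((hasDerivAt_id p.2).const_mul b).const_add (c₀ + a * p.1)).add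
    ((((hasDerivAt_id p.2).pow 2).const_add (p.1 ^ 2)).const_mul (l / 2))).add
    (((((hasDerivAt_id p.2).const_mul B).const_add (A * p.1)).pow (n + 2)).const_mul a₀)
  refine h.deriv.trans ?_
  simp
  ring

lemma pdx_pdx_jetModel : pdx (pdx (jetModel c₀ a b l a₀ A B (n + 2))) =
    fun p => l + a₀ * (n + 2) * (n + 1) * A ^ 2 * (A * p.1 + B * p.2) ^ n := by
  rw [pdx_jetModel]
  funext p
  have h := (((hasDerivAt_id p.1).const_mul l).const_add a).add
    (((((hasDerivAt_id p.1).const_mul A).add_const (B * p.2)).pow (n + 1)).const_mul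
      (a₀ * (n + 2) * A))
  refine h.deriv.trans ?_
  simp
  ring

lemma pdy_pdy_jetModel : pdy (pdy (jetModel c₀ a b l a₀ A B (n + 2))) =
    fun p => l + a₀ * (n + 2) * (n + 1) * B ^ 2 * (A * p.1 + B * p.2) ^ n := by
  rw [pdy_jetModel]
  funext p
  have h := (((hasDerivAt_id p.2).const_mul l).const_add b).add
    (((((hasDerivAt_id p.2).const_mul B).const_add (A * p.1)).pow (n + 1)).const_mul
      (a₀ * (n + 2) * B))
  refine h.deriv.trans ?_
  simp
  ring

lemma pdx_pdy_jetModel : pdx (pdy (jetModel c₀ a b l a₀ A B (n + 2))) =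
    fun p => a₀ * (n + 2) * (n + 1) * (A * B) * (A * p.1 + B * p.2) ^ n := by
  rw [pdy_jetModel]
  funext p
  have h := ((((((hasDerivAt_id p.1).const_mul A).add_const (B * p.2)).pow (n + 1)).const_mul
      (a₀ * (n + 2) * B))).const_add (b + l * p.2)
  refine h.deriv.trans ?_
  simp
  ring

end JetModel

/-- If `(σ · q) ^ n • (b, c) = K (ν · q) ^ n • ((A² - B²) / 2, A B)` for all `q`, with
`ν = (A, B) ≠ 0`, `K ≠ 0` and `σ ≠ 0`, then every `v ⊥ σ` is an eigenvector of
`[[b, c], [c, -b]]`. -/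
lemma eigenvector_of_leading_forms {n : ℕ} (hn : n ≠ 0) {K A B σ₁ σ₂ β γ : ℝ} (hK : K ≠ 0)
    (hAB : (A, B) ≠ ((0 : ℝ), (0 : ℝ))) (hσ : (σ₁, σ₂) ≠ ((0 : ℝ), (0 : ℝ)))
    (hβ : ∀ q : ℝ × ℝ, (q.1 * σ₁ + q.2 * σ₂) ^ n * β =
      K * ((A ^ 2 - B ^ 2) / 2) * (A * q.1 + B * q.2) ^ n)
    (hγ : ∀ q : ℝ × ℝ, (q.1 * σ₁ + q.2 * σ₂) ^ n * γ =
      K * (A * B) * (A * q.1 + B * q.2) ^ n)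
    {v : ℝ × ℝ} (hv : v.1 * σ₁ + v.2 * σ₂ = 0) :
    ∃ μ : ℝ, β * v.1 + γ * v.2 = μ * v.1 ∧ γ * v.1 - β * v.2 = μ * v.2 := by
  have sq_pos : ∀ {x y : ℝ}, (x, y) ≠ ((0 : ℝ), (0 : ℝ)) → 0 < x ^ 2 + y ^ 2 := by
    intro x y h
    by_contra! hle
    exact h (Prod.ext (by nlinarith [sq_nonneg x, sq_nonneg y])
      (by nlinarith [sq_nonneg x, sq_nonneg y]))
  have hA := sq_pos hAB
  have hS := sq_pos hσ
  have hLv : A * v.1 + B * v.2 = 0 := by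
    by_contra hL
    have hLn : (A * v.1 + B * v.2) ^ n ≠ 0 := pow_ne_zero _ hL
    have e1 := hβ v
    have e2 := hγ v
    rw [hv, zero_pow hn, zero_mul, eq_comm, mul_eq_zero, or_iff_left hLn, mul_eq_zero,
      or_iff_right hK] at e1 e2
    nlinarith
  set S := (σ₁ * σ₁ + σ₂ * σ₂) ^ n with hSdef
  have hS0 : S ≠ 0 := pow_ne_zero _ (by nlinarith)
  set M := K * (A * σ₁ + B * σ₂) ^ n with hM
  have e1 : β = M * ((A ^ 2 - B ^ 2) / 2) / S := by
    rw [eq_div_iff hS0]; linear_combination hβ (σ₁, σ₂)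
  have e2 : γ = M * (A * B) / S := by
    rw [eq_div_iff hS0]; linear_combination hγ (σ₁, σ₂)
  refine ⟨-(M * (A ^ 2 + B ^ 2) / 2) / S, ?_, ?_⟩
  · rw [e1, e2]; field_simp; linear_combination 2 * A * M * hLv
  · rw [e1, e2]; field_simp; linear_combination 2 * B * M * hLv

/-- In the setting of the previous proposition (case C.2), with
`D²u − (Δu/2)·Id = sⁿ B` near the origin, `∇s(0,0) ≠ 0`, `B = [[b, c], [c, −b]]` traceless
symmetric and `B(0,0) ≠ 0`, the tangent direction to the curve `{s = 0}` at the origin is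
an eigendirection of `B(0,0)`: every non-zero `v ⊥ ∇s(0,0)` satisfies `B(0,0)v ∥ v`. -/
theorem tangent_direction_is_eigendirection_case_C2
    (u : ℝ × ℝ → ℝ) (V : Set (ℝ × ℝ)) (hVopen : IsOpen V) (hV0 : (0, 0) ∈ V)
    (hu : AnalyticOnNhd ℝ u V)
    (hJ : ∀ p ∈ V, jacDet (lap u) (hessDet u) p = 0)
    (l : ℝ) (hH11 : pdx (pdx u) (0, 0) = l) (hH22 : pdy (pdy u) (0, 0) = l)
    (hH12 : pdx (pdy u) (0, 0) = 0) (hH21 : pdy (pdx u) (0, 0) = 0)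
    (hnp : ¬∃ P : MvPolynomial (Fin 2) ℝ, P.totalDegree ≤ 2 ∧
      ∀ p ∈ V, u p = MvPolynomial.eval ![p.1, p.2] P)
    (n : ℕ) (hn : 1 ≤ n) (a₀ A B : ℝ) (ha₀ : a₀ ≠ 0) (hAB : (A, B) ≠ ((0 : ℝ), (0 : ℝ)))
    (c₀ a b : ℝ)
    (ho : (fun p : ℝ × ℝ => u p - (c₀ + a * p.1 + b * p.2 + l / 2 * (p.1 ^ 2 + p.2 ^ 2)
        + a₀ * (A * p.1 + B * p.2) ^ (n + 2)))
      =o[𝓝 ((0, 0) : ℝ × ℝ)] fun p => ‖p‖ ^ (n + 2))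
    -- `s` and `B = [[bb, cc], [cc, -bb]]` as in the conclusion of the previous result
    (ε : ℝ) (hε : 0 < ε) (hεV : {p : ℝ × ℝ | p.1 ^ 2 + p.2 ^ 2 < ε ^ 2} ⊆ V)
    (s bb cc : ℝ × ℝ → ℝ)
    (hs : AnalyticOnNhd ℝ s {p : ℝ × ℝ | p.1 ^ 2 + p.2 ^ 2 < ε ^ 2})
    (hbb : AnalyticOnNhd ℝ bb {p : ℝ × ℝ | p.1 ^ 2 + p.2 ^ 2 < ε ^ 2})
    (hcc : AnalyticOnNhd ℝ cc {p : ℝ × ℝ | p.1 ^ 2 + p.2 ^ 2 < ε ^ 2})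
    (hs0 : s (0, 0) = 0)
    (hgrad : (pdx s (0, 0), pdy s (0, 0)) ≠ ((0 : ℝ), (0 : ℝ)))
    (hB0 : (bb (0, 0), cc (0, 0)) ≠ ((0 : ℝ), (0 : ℝ)))
    (hfact : ∀ p : ℝ × ℝ, p.1 ^ 2 + p.2 ^ 2 < ε ^ 2 →
      pdx (pdx u) p - lap u p / 2 = s p ^ n * bb p ∧
      pdy (pdy u) p - lap u p / 2 = -(s p ^ n * bb p) ∧
      pdx (pdy u) p = s p ^ n * cc p ∧
      pdy (pdx u) p = s p ^ n * cc p) :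
    ∀ v : ℝ × ℝ, v ≠ (0, 0) → v.1 * pdx s (0, 0) + v.2 * pdy s (0, 0) = 0 →
      ∃ μ : ℝ, bb (0, 0) * v.1 + cc (0, 0) * v.2 = μ * v.1 ∧
        cc (0, 0) * v.1 - bb (0, 0) * v.2 = μ * v.2 := by
  intro v _ hv
  have hball : (0 : ℝ × ℝ) ∈ {p : ℝ × ℝ | p.1 ^ 2 + p.2 ^ 2 < ε ^ 2} := by
    simpa using pow_pos hε 2
  have hball_nhds : {p : ℝ × ℝ | p.1 ^ 2 + p.2 ^ 2 < ε ^ 2} ∈ 𝓝 (0 : ℝ × ℝ) :=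
    (isOpen_lt (by fun_prop) continuous_const).mem_nhds hball
  have hu0 : AnalyticAt ℝ u 0 := hu 0 hV0
  have hw0 := analyticAt_jetModel c₀ a b l a₀ A B (n + 2) 0
  have ho' : (u - jetModel c₀ a b l a₀ A B (n + 2)) =o[𝓝 0] fun y => ‖y‖ ^ (n + 1 + 1) := ho
  have hx := hu0.pdx_sub_isLittleO hw0 ho'
  have hy := hu0.pdy_sub_isLittleO hw0 ho'
  have hxx := hu0.pdx.pdx_sub_isLittleO hw0.pdx hx
  have hyy := hu0.pdy.pdy_sub_isLittleO hw0.pdy hy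
  have hxy := hu0.pdy.pdx_sub_isLittleO hw0.pdy hy
  rw [pdx_pdx_jetModel] at hxx
  rw [pdy_pdy_jetModel] at hyy
  rw [pdx_pdy_jetModel] at hxy
  have hs' : DifferentiableAt ℝ s 0 := (hs 0 hball).differentiableAt
  refine eigenvector_of_leading_forms (n := n) (K := a₀ * (n + 2) * (n + 1)) (by lia)
    (by positivity) hAB hgrad
    (leading_form_eq hs' hs0 (hbb 0 hball).continuousAt ?_)
    (leading_form_eq hs' hs0 (hcc 0 hball).continuousAt ?_) hv
  · refine ((hxx.sub hyy).const_mul_left (1 / 2)).congr' ?_ .rfl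
    filter_upwards [hball_nhds] with z hz
    obtain ⟨h1, h2, -, -⟩ := hfact z hz
    simp only [Pi.sub_apply]
    linear_combination (h1 - h2) / 2
  · refine hxy.congr' ?_ .rfl
    filter_upwards [hball_nhds] with z hz
    simp only [Pi.sub_apply]
    linear_combination (hfact z hz).2.2.1
end
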